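/- arXiv:2211.03963 — 18 statements merged into one kernel-verified Lean document; each statement's English description precedes it below -/
import Mathlib

section
/- Let p ≥ 2 be a real number. Then for every real number α, (p/8)·α² + (1/2^(p+1))·|α|^p ≤ |1+α|^p − 1 − p·α ≤ 2p²·α² + p^p·|α|^p. -/
theorem aux_lower_quad (p : ℝ) (hp : 2 ≤ p) (α : ℝ) :
    1 + p * α + p / 2 * α ^ 2 ≤ |1 + α| ^ p := by
  have h := one_add_mul_self_le_rpow_one_add (s := 2 * α + α ^ 2) (by nlinarith [sq_nonneg (1 + α)])
    (p := p / 2) (by linarith)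
  have e : (1 + (2 * α + α ^ 2)) = |1 + α| ^ (2 : ℝ) := by
    rw [Real.rpow_two, sq_abs]; ring
  rw [e, ← Real.rpow_mul (abs_nonneg _)] at h
  have e2 : 2 * (p / 2) = p := by ring
  rw [e2] at h
  linarith

theorem stmt_0 (p : ℝ) (hp : 2 ≤ p) (α : ℝ) :
    p / 8 * α ^ 2 + 1 / (2 : ℝ) ^ (p + 1) * |α| ^ p
      ≤ |1 + α| ^ p - 1 - p * α ∧
    |1 + α| ^ p - 1 - p * α ≤ 2 * p ^ 2 * α ^ 2 + p ^ p * |α| ^ p := by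
  have hp0 : 0 ≤ p := by linarith
  constructor
  · have hB := aux_lower_quad p hp α
    have e : 1 / (2 : ℝ) ^ (p + 1) * |α| ^ p = 1 / 2 * (|α| / 2) ^ p := by
      rw [Real.div_rpow (abs_nonneg _) (by norm_num), Real.rpow_add_one (by norm_num)]
      field_simp
    rw [e]
    have hpa : 0 ≤ (p - 2) * α ^ 2 := mul_nonneg (by linarith) (sq_nonneg _)
    rcases le_or_gt |α| 2 with h | h
    · have h1 : (|α| / 2) ^ p ≤ (|α| / 2) ^ (2 : ℝ) :=
        Real.rpow_le_rpow_of_exponent_ge' (by positivity) (by linarith) (by norm_num) hp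
      rw [Real.rpow_two, div_pow, sq_abs] at h1
      nlinarith
    · rcases le_or_gt α 0 with ha | ha
      · rw [abs_of_nonpos ha] at h ⊢
        have h1 : (-α / 2) ^ p ≤ |1 + α| ^ p := by
          apply Real.rpow_le_rpow (by linarith) _ hp0
          rw [abs_of_nonpos (by linarith)]; linarith
        have h2 : 0 ≤ p * (-α) := mul_nonneg hp0 (by linarith)
        have h3 : 4 ≤ α ^ 2 := by nlinarith
        nlinarith
      · rw [abs_of_pos ha] at h ⊢
        have h1 : 4 * (α / 2) ^ p ≤ |1 + α| ^ p := by
          have h4 : (2 : ℝ) ^ (2 : ℝ) ≤ 2 ^ p := Real.rpow_le_rpow_of_exponent_le (by norm_num) hp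
          rw [Real.rpow_two] at h4
          have h5 : (2 * (α / 2)) ^ p ≤ |1 + α| ^ p := by
            apply Real.rpow_le_rpow (by linarith) _ hp0
            rw [abs_of_pos (by linarith)]; linarith
          rw [Real.mul_rpow (by norm_num) (by linarith)] at h5
          have : 0 ≤ (α / 2) ^ p := by positivity
          nlinarith
        have h2 : 0 ≤ p * (α * (α - 2)) := mul_nonneg hp0 (mul_nonneg ha.le (by linarith))
        have h3 : 4 ≤ α ^ 2 := by nlinarith
        nlinarith
  · rw [← Real.mul_rpow hp0 (abs_nonneg _)]
    rcases le_or_gt (p * |α|) 2 with h | h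
    · have ha : |α| ≤ 1 := by nlinarith [abs_nonneg α]
      obtain ⟨ha1, ha2⟩ := abs_le.1 ha
      have hnn : 0 ≤ (p * |α|) ^ p := by positivity
      have ht : |p * α / 2| ≤ 1 := by
        rw [abs_div, abs_mul, abs_of_nonneg hp0, abs_of_pos (by norm_num : (0:ℝ) < 2)]; linarith
      have h1 : |1 + α| ^ p ≤ Real.exp (p * α / 2) ^ 2 := by
        rw [abs_of_nonneg (by linarith), ← Real.exp_nat_mul]
        calc (1 + α) ^ p ≤ (Real.exp α) ^ p := by
              apply Real.rpow_le_rpow (by linarith) _ hp0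
              linarith [Real.add_one_le_exp α]
          _ = _ := by rw [← Real.exp_mul]; congr 1; push_cast; ring
      have h2 := (abs_le.1 (Real.abs_exp_sub_one_sub_id_le ht)).2
      have e : 2 * p ^ 2 * α ^ 2 = 8 * (p * α / 2) ^ 2 := by ring
      have e' : p * α = 2 * (p * α / 2) := by ring
      have h3 := Real.exp_pos (p * α / 2)
      rw [e]
      generalize Real.exp (p * α / 2) = x at *
      obtain ⟨t1, t2⟩ := abs_le.1 ht
      generalize p * α / 2 = t at *
      rw [e']
      have h4 : x ^ 2 ≤ (1 + t + t ^ 2) ^ 2 := pow_le_pow_left₀ h3.le (by linarith) 2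
      have h5 : 0 ≤ t ^ 2 * (5 - 2 * t - t ^ 2) := mul_nonneg (sq_nonneg _) (by nlinarith)
      nlinarith
    · have h1 : |1 + α| ^ p ≤ (p * |α|) ^ p := by
        apply Real.rpow_le_rpow (abs_nonneg _) _ hp0
        have := abs_add_le 1 α
        rw [abs_one] at this
        nlinarith [abs_nonneg α]
      have h2 : 2 * p ^ 2 * α ^ 2 = 2 * (p * |α|) ^ 2 := by rw [mul_pow, sq_abs]; ring
      have h3 : -(p * α) ≤ p * |α| := by
        have := mul_le_mul_of_nonneg_left (neg_abs_le α) hp0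
        linarith
      nlinarith
end

section
/- Let p ≥ 2 be a real number, and let x, Δ ∈ ℝ^m. Define r ∈ ℝ^m coordinatewise by r_i = |x_i|^(p−2) (with the convention 0^(p−2) = 0) and g ∈ ℝ^m coordinatewise by g_i = p·|x_i|^(p−2)·x_i. Then (p/8)·Σ_i r_i·Δ_i² + (1/2^(p+1))·‖Δ‖_p^p ≤ ‖x+Δ‖_p^p − ‖x‖_p^p − gᵀΔ ≤ 2p²·Σ_i r_i·Δ_i² + p^p·‖Δ‖_p^p. -/
theorem aux_bern (p : ℝ) (hp : 2 ≤ p) (t : ℝ) :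
    1 + p * t + p * t ^ 2 / 2 ≤ |1 + t| ^ p := by
  have h := one_add_mul_self_le_rpow_one_add (s := 2 * t + t ^ 2) (p := p / 2)
    (by nlinarith [sq_nonneg (1 + t)]) (by linarith)
  have e : (1 + (2 * t + t ^ 2)) = |1 + t| ^ (2 : ℝ) := by
    rw [Real.rpow_two, sq_abs]; ring
  rw [e, ← Real.rpow_mul (abs_nonneg _)] at h
  have e2 : (2 : ℝ) * (p / 2) = p := by ring
  rw [e2] at h
  linarith

theorem aux_lower (p : ℝ) (hp : 2 ≤ p) (t : ℝ) :
    p / 8 * t ^ 2 + 1 / (2 : ℝ) ^ (p + 1) * |t| ^ p ≤ |1 + t| ^ p - 1 - p * t := by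
  have hb := aux_bern p hp t
  have e : 1 / (2 : ℝ) ^ (p + 1) * |t| ^ p = (|t| / 2) ^ p / 2 := by
    rw [Real.rpow_add (by norm_num), Real.div_rpow (abs_nonneg _) (by norm_num), Real.rpow_one]
    field_simp
  rw [e]
  have hB0 : 0 ≤ (|t| / 2) ^ p := by positivity
  rcases le_total |t| 2 with h | h
  · have h1 : (|t| / 2) ^ p ≤ (|t| / 2) ^ (2 : ℝ) :=
      Real.rpow_le_rpow_of_exponent_ge_of_imp (by positivity) (by linarith) hp
        (by intro _ h2; linarith)
    rw [Real.rpow_two, div_pow, sq_abs] at h1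
    nlinarith [sq_nonneg t, mul_nonneg (sub_nonneg.2 hp) (sq_nonneg t)]
  · rcases le_total 0 t with ht | ht
    · rw [abs_of_nonneg ht] at h hB0 ⊢
      rw [abs_of_nonneg (by linarith : 0 ≤ 1 + t)] at hb ⊢
      have h1 : t ^ p ≤ (1 + t) ^ p := Real.rpow_le_rpow ht (by linarith) (by linarith)
      have h2 : t ^ p = 2 ^ p * (t / 2) ^ p := by
        rw [← Real.mul_rpow (by norm_num) (by positivity)]; congr 1; ring
      have h3 : (4 : ℝ) ≤ 2 ^ p := by
        calc (4 : ℝ) = 2 ^ (2 : ℝ) := by rw [Real.rpow_two]; norm_num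
          _ ≤ 2 ^ p := Real.rpow_le_rpow_of_exponent_le (by norm_num) hp
      have h4 : 4 * (t / 2) ^ p ≤ (1 + t) ^ p := by nlinarith
      have h5 : 0 ≤ p * (t * (t - 2)) := by
        apply mul_nonneg (by linarith); apply mul_nonneg ht; linarith
      nlinarith
    · rw [abs_of_nonpos ht] at h hB0 ⊢
      rw [abs_of_nonpos (by linarith : 1 + t ≤ 0)] at hb ⊢
      have h1 : (-t / 2) ^ p ≤ (-(1 + t)) ^ p :=
        Real.rpow_le_rpow (by linarith) (by linarith) (by linarith)
      nlinarith [mul_nonneg (by linarith : 0 ≤ p) (sq_nonneg t),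
        mul_nonneg (by linarith : 0 ≤ p - 2) (by linarith : 0 ≤ -t - 2)]

theorem aux_exp (p : ℝ) (hp : 2 ≤ p) (t : ℝ) (h : 0 ≤ 1 + t) :
    |1 + t| ^ p ≤ Real.exp (p * t) := by
  rw [abs_of_nonneg h, mul_comm, Real.exp_mul]
  exact Real.rpow_le_rpow h (by linarith [Real.add_one_le_exp t]) (by linarith)

theorem aux_upper (p : ℝ) (hp : 2 ≤ p) (t : ℝ) :
    |1 + t| ^ p - 1 - p * t ≤ 2 * p ^ 2 * t ^ 2 + p ^ p * |t| ^ p := by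
  have e : p ^ p * |t| ^ p = (p * |t|) ^ p := by
    rw [Real.mul_rpow (by linarith) (abs_nonneg _)]
  rw [e]
  have hB0 : 0 ≤ (p * |t|) ^ p := by positivity
  rcases le_total (p * |t|) 1 with h | h
  · have h0 : |p * t| ≤ 1 := by rwa [abs_mul, abs_of_nonneg (by linarith : 0 ≤ p)]
    have h1 : 0 ≤ 1 + t := by nlinarith [neg_abs_le t, abs_nonneg t]
    have h2 := aux_exp p hp t h1
    have h3 := (abs_le.1 (Real.abs_exp_sub_one_sub_id_le h0)).2
    nlinarith [sq_nonneg (p * t)]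
  · rcases le_total 0 t with ht | ht
    · rw [abs_of_nonneg ht] at h hB0 ⊢
      rcases le_total (1 + t) (p * t) with h1 | h1
      · have h2 : |1 + t| ^ p ≤ (p * t) ^ p := by
          rw [abs_of_nonneg (by linarith)]
          exact Real.rpow_le_rpow (by linarith) h1 (by linarith)
        nlinarith [sq_nonneg (p * t)]
      · have h2 := aux_exp p hp t (by linarith)
        have ht1 : t ≤ 1 := by nlinarith
        have hu : p * t ≤ 2 := by linarith
        obtain ⟨u, hudef⟩ : ∃ u, u = p * t := ⟨_, rfl⟩
        have hg : 2 * p ^ 2 * t ^ 2 = 2 * u ^ 2 := by rw [hudef]; ring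
        rw [hg]
        rw [← hudef] at h h2 hu hB0 ⊢
        have h3 := (abs_le.1 (Real.abs_exp_sub_one_sub_id_le (x := u - 1)
          (abs_le.2 ⟨by linarith, by linarith⟩))).2
        have h4 : Real.exp u = Real.exp 1 * Real.exp (u - 1) := by
          rw [← Real.exp_add]; congr 1; ring
        have h5 := Real.exp_one_lt_d9
        have h6 : Real.exp u ≤ 2.72 * (1 - u + u ^ 2) := by
          rw [h4]
          apply mul_le_mul (by linarith) (by nlinarith) (Real.exp_pos _).le (by norm_num)
        nlinarith [mul_nonneg (sub_nonneg.2 h) (sub_nonneg.2 hu)]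
    · rw [abs_of_nonpos ht] at h hB0 ⊢
      have h2 : |1 + t| ^ p ≤ 1 + (p * -t) ^ p := by
        rcases le_total (-2) t with h1 | h1
        · have := Real.rpow_le_one (abs_nonneg (1 + t))
            (abs_le.2 ⟨by linarith, by linarith⟩) (by linarith : 0 ≤ p)
          linarith
        · have : |1 + t| ^ p ≤ (p * -t) ^ p := by
            rw [abs_of_nonpos (by linarith)]
            exact Real.rpow_le_rpow (by linarith) (by nlinarith) (by linarith)
          linarith
      nlinarith [sq_nonneg (p * t)]

theorem aux_scalar (p : ℝ) (hp : 2 ≤ p) (x d : ℝ) :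
    p / 8 * ((if x = 0 then 0 else |x| ^ (p - 2)) * d ^ 2) + 1 / (2 : ℝ) ^ (p + 1) * |d| ^ p
      ≤ |x + d| ^ p - |x| ^ p - p * (if x = 0 then 0 else |x| ^ (p - 2)) * x * d ∧
    |x + d| ^ p - |x| ^ p - p * (if x = 0 then 0 else |x| ^ (p - 2)) * x * d
      ≤ 2 * p ^ 2 * ((if x = 0 then 0 else |x| ^ (p - 2)) * d ^ 2) + p ^ p * |d| ^ p := by
  by_cases hx : x = 0
  · subst hx
    have h0 : (0 : ℝ) ^ p = 0 := Real.zero_rpow (by linarith)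
    have hd : 0 ≤ |d| ^ p := by positivity
    have h1 : 1 / (2 : ℝ) ^ (p + 1) ≤ 1 := by
      rw [div_le_one (by positivity)]
      exact Real.one_le_rpow (by norm_num) (by linarith)
    have h2 : 1 ≤ p ^ p := Real.one_le_rpow (by linarith) (by linarith)
    simp only [if_true, abs_zero, h0, zero_add]
    constructor <;> nlinarith
  · simp only [if_neg hx]
    obtain ⟨t, rfl⟩ : ∃ t, d = x * t := ⟨d / x, by field_simp⟩
    have hA : |x| ^ p = |x| ^ (p - 2) * x ^ 2 := by
      rw [← sq_abs x, ← Real.rpow_two, ← Real.rpow_add (abs_pos.2 hx)]; congr 1; ring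
    have e1 : |x + x * t| ^ p = |x| ^ p * |1 + t| ^ p := by
      rw [← Real.mul_rpow (abs_nonneg _) (abs_nonneg _), ← abs_mul]; congr 2; ring
    have e2 : |x * t| ^ p = |x| ^ p * |t| ^ p := by
      rw [← Real.mul_rpow (abs_nonneg _) (abs_nonneg _), ← abs_mul]
    have e3 : |x| ^ (p - 2) * (x * t) ^ 2 = |x| ^ p * t ^ 2 := by rw [hA]; ring
    have e4 : p * |x| ^ (p - 2) * x * (x * t) = |x| ^ p * (p * t) := by rw [hA]; ring
    have hX : 0 ≤ |x| ^ p := by positivity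
    rw [e1, e2, e3, e4]
    have l := mul_le_mul_of_nonneg_left (aux_lower p hp t) hX
    have u := mul_le_mul_of_nonneg_left (aux_upper p hp t) hX
    constructor <;> linarith

theorem stmt_1 (p : ℝ) (hp : 2 ≤ p) (m : ℕ) (x Δ : Fin m → ℝ)
    (r g : Fin m → ℝ)
    (hr : ∀ i, r i = if x i = 0 then 0 else |x i| ^ (p - 2))
    (hg : ∀ i, g i = p * (if x i = 0 then 0 else |x i| ^ (p - 2)) * x i) :
    p / 8 * ∑ i, r i * (Δ i) ^ 2 + 1 / (2 : ℝ) ^ (p + 1) * ∑ i, |Δ i| ^ p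
      ≤ (∑ i, |x i + Δ i| ^ p) - (∑ i, |x i| ^ p) - ∑ i, g i * Δ i ∧
    (∑ i, |x i + Δ i| ^ p) - (∑ i, |x i| ^ p) - ∑ i, g i * Δ i
      ≤ 2 * p ^ 2 * ∑ i, r i * (Δ i) ^ 2 + p ^ p * ∑ i, |Δ i| ^ p := by
  simp only [Finset.mul_sum, ← Finset.sum_add_distrib, ← Finset.sum_sub_distrib]
  constructor
  · apply Finset.sum_le_sum
    intro i _
    rw [hr, hg]
    exact (aux_scalar p hp (x i) (Δ i)).1
  · apply Finset.sum_le_sum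
    intro i _
    rw [hr, hg]
    exact (aux_scalar p hp (x i) (Δ i)).2
end

section
/- Let p ≥ 2 be a real number, d ∈ ℝ^n, M ∈ ℝ^(m₁×n), N ∈ ℝ^(m₂×n), and define f(x) = dᵀx + ‖Mx‖₂² + ‖Nx‖_p^p for x ∈ ℝ^n. Fix x ∈ ℝ^n and set g = (1/p)·d + (2/p)·MᵀMx + Nᵀ(|Nx|^(p−2) ⊙ (Nx)) ∈ ℝ^n and R = (2/p²)·MᵀM + 2·Nᵀ·Diag(|Nx|^(p−2))·N ∈ ℝ^(n×n), and define res_p(Δ) = gᵀΔ − ΔᵀRΔ − ‖NΔ‖_p^p. Then for every Δ ∈ ℝ^n: (i) res_p(Δ) ≤ f(x) − f(x − Δ/p), and (ii) f(x) − f(x − 16Δ) ≤ 16p · res_p(Δ). -/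
open Matrix

lemma normOne (p : ℝ) (hp : 2 ≤ p) (s : ℝ) :
    |1 - 1 / p * s| ^ p ≤ 1 - s + 2 * s ^ 2 + |s| ^ p := by
  have hp0 : 0 < p := by linarith
  have hsp : 0 ≤ |s| ^ p := by positivity
  rcases le_total |s| 2 with h | h
  · obtain ⟨h1, h2⟩ := abs_le.1 h
    have hs : |1 / p * s| ≤ 1 := by
      rw [abs_mul, abs_of_pos (by positivity), one_div_mul_eq_div, div_le_one hp0]; linarith
    have h0 : 0 ≤ 1 - 1 / p * s := by linarith [(abs_le.1 hs).2]
    rw [abs_of_nonneg h0]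
    have e1 : (1 - 1 / p * s) ^ p ≤ Real.exp (-s) := by
      have : 1 - 1 / p * s ≤ Real.exp (-(1 / p * s)) := by
        linarith [Real.add_one_le_exp (-(1 / p * s))]
      calc (1 - 1 / p * s) ^ p ≤ (Real.exp (-(1 / p * s))) ^ p :=
            Real.rpow_le_rpow h0 this hp0.le
        _ = Real.exp (-s) := by
            rw [← Real.exp_mul]; congr 1; field_simp
    have e2 : Real.exp (-s) = Real.exp (-s / 2) ^ 2 := by
      rw [← Real.exp_nat_mul]; congr 1; push_cast; ring
    have hy : |-s / 2| ≤ 1 := by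
      rw [abs_le]; constructor <;> linarith
    have e3 := (abs_le.1 (Real.abs_exp_sub_one_sub_id_le hy)).2
    have e4 : Real.exp (-s / 2) ^ 2 ≤ (1 + (-s / 2) + (-s / 2) ^ 2) ^ 2 := by
      apply pow_le_pow_left₀ (Real.exp_pos _).le; linarith
    have e5 : (1 + (-s / 2) + (-s / 2) ^ 2) ^ 2 ≤ 1 - s + 2 * s ^ 2 := by
      nlinarith [mul_nonneg (sq_nonneg s) (by linarith : 0 ≤ s + 2),
        mul_nonneg (sq_nonneg s) (by nlinarith : 0 ≤ 4 - s ^ 2)]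
    linarith
  · have e : |1 - 1 / p * s| ≤ |s| := by
      have h1 : |1 - 1 / p * s| ≤ |1| + |1 / p * s| := abs_sub _ _
      have h2 : |1 / p * s| ≤ |s| / 2 := by
        rw [abs_mul, abs_of_pos (by positivity), one_div_mul_eq_div]
        gcongr
      rw [abs_one] at h1
      linarith
    have := Real.rpow_le_rpow (abs_nonneg _) e hp0.le
    nlinarith [sq_nonneg (s - 1), sq_nonneg s]

lemma bern (p : ℝ) (hp : 2 ≤ p) (c : ℝ) : 1 + p / 2 * (c ^ 2 - 1) ≤ |c| ^ p := by
  have h := one_add_mul_self_le_rpow_one_add (s := c ^ 2 - 1) (by nlinarith [sq_nonneg c])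
    (p := p / 2) (by linarith)
  have e : (1 + (c ^ 2 - 1)) ^ (p / 2) = |c| ^ p := by
    rw [add_sub_cancel, ← sq_abs, ← Real.rpow_natCast, ← Real.rpow_mul (abs_nonneg _)]
    congr 1; push_cast; ring
  rwa [e] at h

lemma normTwo (p : ℝ) (hp : 2 ≤ p) (s : ℝ) :
    1 - |1 - 16 * s| ^ p ≤ 16 * p * (s - 2 * s ^ 2 - |s| ^ p) := by
  have hB := bern p hp (1 - 16 * s)
  rcases le_total |s| 1 with h | h
  · have hS : |s| ^ p ≤ s ^ 2 := by
      rw [← sq_abs, ← Real.rpow_natCast]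
      exact Real.rpow_le_rpow_of_exponent_ge_of_imp (abs_nonneg _) h (by simpa using hp)
        (by intro _ h2; linarith)
    nlinarith [mul_le_mul_of_nonneg_left hS (by linarith : 0 ≤ p),
      mul_nonneg (by linarith : 0 ≤ p) (sq_nonneg s)]
  · have hS : 0 ≤ |s| ^ p := by positivity
    have h15 := bern p hp 15
    rw [abs_of_pos (by norm_num)] at h15
    have e : 15 * |s| ≤ |1 - 16 * s| := by
      have := abs_sub_abs_le_abs_sub (16 * s) 1
      rw [abs_mul, abs_one, abs_of_pos (by norm_num : (0:ℝ) < 16), abs_sub_comm] at this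
      linarith
    have e2 := Real.rpow_le_rpow (by positivity) e (by linarith : 0 ≤ p)
    rw [Real.mul_rpow (by norm_num) (abs_nonneg _)] at e2
    have e3 : 64 * p * |s| ^ p ≤ (15:ℝ) ^ p * |s| ^ p :=
      mul_le_mul_of_nonneg_right (by linarith) hS
    have hs2 : |s| ≤ s ^ 2 := by rw [← sq_abs]; nlinarith
    have hs3 : 1 ≤ s ^ 2 := by linarith
    have hs4 : 0 ≤ s ^ 2 + s := by linarith [neg_abs_le s]
    nlinarith [mul_nonneg (by linarith : 0 ≤ p) hs4,
      mul_nonneg (by linarith : 0 ≤ p) (by linarith : 0 ≤ s ^ 2 - 1)]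

lemma scal (p : ℝ) (hp : 2 ≤ p) (a b : ℝ) :
    (if a = 0 then 0 else |a| ^ (p - 2)) * a * b
        - 2 * ((if a = 0 then 0 else |a| ^ (p - 2)) * b ^ 2) - |b| ^ p
      ≤ |a| ^ p - |a - 1 / p * b| ^ p ∧
    |a| ^ p - |a - 16 * b| ^ p ≤ 16 * p * ((if a = 0 then 0 else |a| ^ (p - 2)) * a * b
        - 2 * ((if a = 0 then 0 else |a| ^ (p - 2)) * b ^ 2) - |b| ^ p) := by
  have hp0 : 0 < p := by linarith
  by_cases ha : a = 0
  · subst ha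
    have hb : 0 ≤ |b| ^ p := by positivity
    simp only [if_true, abs_zero, Real.zero_rpow hp0.ne', zero_sub, abs_neg, abs_mul, zero_mul,
      mul_zero, sub_zero]
    constructor
    · have : |1 / p| * |b| ≤ |b| := by
        rw [abs_of_pos (by positivity), one_div_mul_eq_div]
        exact div_le_self (abs_nonneg _) (by linarith)
      have := Real.rpow_le_rpow (by positivity) this hp0.le
      linarith
    · have h := bern p hp 16
      rw [Real.mul_rpow (abs_nonneg _) (abs_nonneg _)]
      rw [abs_of_pos (by norm_num : (0:ℝ) < 16)] at h ⊢
      have : 16 * p * |b| ^ p ≤ (16:ℝ) ^ p * |b| ^ p :=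
        mul_le_mul_of_nonneg_right (by linarith) hb
      linarith
  · obtain ⟨s, rfl⟩ : ∃ s, b = a * s := ⟨b / a, by field_simp⟩
    have hA : 0 ≤ |a| ^ p := by positivity
    have hW : |a| ^ p = |a| ^ (p - 2) * a ^ 2 := by
      rw [← sq_abs a, ← Real.rpow_natCast |a|, ← Real.rpow_add (abs_pos.2 ha)]
      congr 1; push_cast; ring
    have e1 : |a| ^ (p - 2) * a * (a * s) = |a| ^ p * s := by rw [hW]; ring
    have e2 : |a| ^ (p - 2) * (a * s) ^ 2 = |a| ^ p * s ^ 2 := by rw [hW]; ring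
    have e3 : ∀ c : ℝ, |a - c * (a * s)| ^ p = |a| ^ p * |1 - c * s| ^ p := by
      intro c
      rw [← Real.mul_rpow (abs_nonneg _) (abs_nonneg _), ← abs_mul]; congr 2; ring
    have e4 : |a * s| ^ p = |a| ^ p * |s| ^ p := by
      rw [abs_mul, Real.mul_rpow (abs_nonneg _) (abs_nonneg _)]
    simp only [if_neg ha, e1, e2, e3, e4]
    have h1 := mul_le_mul_of_nonneg_left (normOne p hp s) hA
    have h2 := mul_le_mul_of_nonneg_left (normTwo p hp s) hA
    constructor <;> linarith

theorem stmt_2 (p : ℝ) (hp : 2 ≤ p) (n m₁ m₂ : ℕ)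
    (d : Fin n → ℝ) (M : Matrix (Fin m₁) (Fin n) ℝ) (N : Matrix (Fin m₂) (Fin n) ℝ)
    (f : (Fin n → ℝ) → ℝ)
    (hf : ∀ y, f y = d ⬝ᵥ y + (∑ i, (M.mulVec y i) ^ 2) + ∑ i, |N.mulVec y i| ^ p)
    (x : Fin n → ℝ)
    (g : Fin n → ℝ)
    (hg : g = fun j => (1 / p) * d j + (2 / p) * ((Mᵀ).mulVec (M.mulVec x)) j
        + ((Nᵀ).mulVec (fun i =>
            (if N.mulVec x i = 0 then 0 else |N.mulVec x i| ^ (p - 2)) * N.mulVec x i)) j)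
    (R : Matrix (Fin n) (Fin n) ℝ)
    (hR : R = (2 / p ^ 2) • (Mᵀ * M)
        + (2 : ℝ) • (Nᵀ * Matrix.diagonal
            (fun i => if N.mulVec x i = 0 then 0 else |N.mulVec x i| ^ (p - 2)) * N))
    (res : (Fin n → ℝ) → ℝ)
    (hres : ∀ Δ, res Δ = g ⬝ᵥ Δ - Δ ⬝ᵥ R.mulVec Δ - ∑ i, |N.mulVec Δ i| ^ p) :
    ∀ Δ : Fin n → ℝ,
      res Δ ≤ f x - f (x - (1 / p) • Δ) ∧
      f x - f (x - (16 : ℝ) • Δ) ≤ 16 * p * res Δ := by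
  intro Δ
  have hp0 : 0 < p := by linarith
  set a := N.mulVec x with ha
  set b := N.mulVec Δ with hb
  set u := M.mulVec x with hu
  set v := M.mulVec Δ with hv
  set W : Fin m₂ → ℝ := fun i => if a i = 0 then 0 else |a i| ^ (p - 2) with hW
  have hgd : g ⬝ᵥ Δ = (1 / p) * (d ⬝ᵥ Δ) + (2 / p) * (∑ i, u i * v i) + ∑ i, W i * a i * b i := by
    have e : g = (1 / p) • d + (2 / p) • (Mᵀ).mulVec u + (Nᵀ).mulVec (fun i => W i * a i) := by
      rw [hg]; ext j; simp [hW]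
    have e1 : (Mᵀ).mulVec u ⬝ᵥ Δ = ∑ i, u i * v i := by
      rw [mulVec_transpose, ← dotProduct_mulVec]; rfl
    have e2 : (Nᵀ).mulVec (fun i => W i * a i) ⬝ᵥ Δ = ∑ i, W i * a i * b i := by
      rw [mulVec_transpose, ← dotProduct_mulVec]; rfl
    rw [e, add_dotProduct, add_dotProduct, smul_dotProduct, smul_dotProduct, e1, e2]
    simp only [smul_eq_mul]
  have hRd : Δ ⬝ᵥ R.mulVec Δ = (2 / p ^ 2) * (∑ i, v i ^ 2) + 2 * ∑ i, W i * b i ^ 2 := by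
    have e1 : Δ ⬝ᵥ (Mᵀ * M).mulVec Δ = ∑ i, v i ^ 2 := by
      rw [← mulVec_mulVec, dotProduct_mulVec, vecMul_transpose]
      simp only [dotProduct, ← hv, sq]
    have e2 : Δ ⬝ᵥ (Nᵀ * Matrix.diagonal W * N).mulVec Δ = ∑ i, W i * b i ^ 2 := by
      rw [← mulVec_mulVec, ← mulVec_mulVec, dotProduct_mulVec, vecMul_transpose]
      simp only [dotProduct, ← hb, mulVec_diagonal]
      exact Finset.sum_congr rfl fun i _ => by ring
    rw [hR, add_mulVec, smul_mulVec, smul_mulVec, dotProduct_add, dotProduct_smul,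
      dotProduct_smul, e1, e2]
    simp only [smul_eq_mul]
  have hfc : ∀ c : ℝ, f x - f (x - c • Δ) = c * (d ⬝ᵥ Δ) + 2 * c * (∑ i, u i * v i)
      - c ^ 2 * (∑ i, v i ^ 2) + ∑ i, (|a i| ^ p - |a i - c * b i| ^ p) := by
    intro c
    have e1 : ∑ i, (M.mulVec (x - c • Δ) i) ^ 2
        = (∑ i, u i ^ 2) - 2 * c * (∑ i, u i * v i) + c ^ 2 * (∑ i, v i ^ 2) := by
      rw [mulVec_sub, mulVec_smul, Finset.mul_sum, Finset.mul_sum, ← Finset.sum_sub_distrib,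
        ← Finset.sum_add_distrib]
      refine Finset.sum_congr rfl fun i _ => ?_
      simp only [Pi.sub_apply, Pi.smul_apply, smul_eq_mul, ← hu, ← hv]
      ring
    have e2 : ∑ i, |N.mulVec (x - c • Δ) i| ^ p = ∑ i, |a i - c * b i| ^ p := by
      rw [mulVec_sub, mulVec_smul]
      rfl
    rw [hf, hf, e1, e2, dotProduct_sub, dotProduct_smul, Finset.sum_sub_distrib]
    simp only [smul_eq_mul, ← hu, ← ha]
    ring
  have hV : 0 ≤ ∑ i, v i ^ 2 := Finset.sum_nonneg fun i _ => sq_nonneg _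
  have hres' : res Δ = (1 / p) * (d ⬝ᵥ Δ) + (2 / p) * (∑ i, u i * v i)
      - (2 / p ^ 2) * (∑ i, v i ^ 2)
      + ∑ i, (W i * a i * b i - 2 * (W i * b i ^ 2) - |b i| ^ p) := by
    rw [hres, hgd, hRd, Finset.sum_sub_distrib, Finset.sum_sub_distrib, ← Finset.mul_sum]
    ring
  have hs := fun i => scal p hp (a i) (b i)
  rw [hres', hfc, hfc]
  constructor
  · have h1 := Finset.sum_le_sum (s := Finset.univ) fun i _ => (hs i).1
    have h2 : (1 / p) ^ 2 * (∑ i, v i ^ 2) ≤ (2 / p ^ 2) * (∑ i, v i ^ 2) := by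
      apply mul_le_mul_of_nonneg_right _ hV
      rw [div_pow]; gcongr; norm_num
    have h3 : 2 * (1 / p) = 2 / p := by ring
    rw [h3]
    linarith
  · have h1 := Finset.sum_le_sum (s := Finset.univ) fun i _ => (hs i).2
    rw [← Finset.mul_sum] at h1
    have h2 : 16 * p * (2 / p ^ 2) * (∑ i, v i ^ 2) ≤ 16 ^ 2 * (∑ i, v i ^ 2) := by
      apply mul_le_mul_of_nonneg_right _ hV
      have : 16 * p * (2 / p ^ 2) = 32 / p := by field_simp; norm_num
      rw [this, div_le_iff₀ hp0]; linarith
    have h3 : ∀ D U V S : ℝ, 16 * p * (1 / p * D + 2 / p * U - 2 / p ^ 2 * V + S)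
        = 16 * D + 2 * 16 * U - 16 * p * (2 / p ^ 2) * V + 16 * p * S := by
      intro D U V S; field_simp
    rw [h3]
    linarith
end

section
/- Let p ≥ 2 be a real number, g ∈ ℝ^n, R ∈ ℝ^(n×n) symmetric positive semidefinite, N ∈ ℝ^(m×n), A ∈ ℝ^(d×n), and define res_p(Δ) = gᵀΔ − ΔᵀRΔ − ‖NΔ‖_p^p. Suppose Δ* ∈ ℝ^n satisfies AΔ* = 0 and res_p(Δ*) ≥ res_p(Δ) for every Δ with AΔ = 0. Then gᵀΔ* = 2·Δ*ᵀRΔ* + p·‖NΔ*‖_p^p, and consequently res_p(Δ*) = Δ*ᵀRΔ* + (p−1)·‖NΔ*‖_p^p; in particular, if res_p(Δ*) ≤ ζ for some real ζ, then Δ*ᵀRΔ* + ‖NΔ*‖_p^p ≤ ζ. -/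
open Matrix

theorem stmt_3 (p : ℝ) (hp : 2 ≤ p) (n m d : ℕ)
    (g : Fin n → ℝ) (R : Matrix (Fin n) (Fin n) ℝ) (hR : R.PosSemidef)
    (N : Matrix (Fin m) (Fin n) ℝ) (A : Matrix (Fin d) (Fin n) ℝ)
    (res : (Fin n → ℝ) → ℝ)
    (hres : ∀ Δ, res Δ = g ⬝ᵥ Δ - Δ ⬝ᵥ R.mulVec Δ - ∑ i, |N.mulVec Δ i| ^ p)
    (Δs : Fin n → ℝ) (hfeas : A.mulVec Δs = 0)
    (hopt : ∀ Δ, A.mulVec Δ = 0 → res Δ ≤ res Δs) :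
    g ⬝ᵥ Δs = 2 * (Δs ⬝ᵥ R.mulVec Δs) + p * ∑ i, |N.mulVec Δs i| ^ p ∧
    res Δs = Δs ⬝ᵥ R.mulVec Δs + (p - 1) * ∑ i, |N.mulVec Δs i| ^ p ∧
    ∀ ζ : ℝ, res Δs ≤ ζ → Δs ⬝ᵥ R.mulVec Δs + ∑ i, |N.mulVec Δs i| ^ p ≤ ζ := by
  set a := g ⬝ᵥ Δs with ha
  set b := Δs ⬝ᵥ R.mulVec Δs with hb
  set c := ∑ i, |N.mulVec Δs i| ^ p with hc
  have hc0 : 0 ≤ c := Finset.sum_nonneg fun i _ => Real.rpow_nonneg (abs_nonneg _) _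
  have hscale : ∀ t : ℝ, 0 < t → res (t • Δs) = t * a - t ^ 2 * b - t ^ p * c := by
    intro t ht
    rw [hres, Matrix.mulVec_smul, Matrix.mulVec_smul]
    simp only [dotProduct_smul, smul_dotProduct, smul_eq_mul, Pi.smul_apply]
    have h1 : ∑ i, |t * N.mulVec Δs i| ^ p = t ^ p * c := by
      rw [hc, Finset.mul_sum]
      refine Finset.sum_congr rfl fun i _ => ?_
      rw [abs_mul, abs_of_pos ht, Real.mul_rpow ht.le (abs_nonneg _)]
    rw [h1, ← ha, ← hb]
    ring
  have hmax : IsLocalMax (fun t : ℝ => t * a - t ^ 2 * b - t ^ p * c) 1 := by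
    filter_upwards [lt_mem_nhds (zero_lt_one' ℝ)] with t ht
    have h := hopt (t • Δs) (by rw [Matrix.mulVec_smul, hfeas, smul_zero])
    rw [hscale t ht] at h
    have h1 := hscale 1 one_pos
    rw [one_smul] at h1
    rw [h1] at h
    exact h
  have hder : HasDerivAt (fun t : ℝ => t * a - t ^ 2 * b - t ^ p * c)
      (1 * a - (((2 : ℕ) : ℝ) * 1 ^ (2 - 1)) * b - (p * 1 ^ (p - 1)) * c) 1 :=
    (((hasDerivAt_id' (1 : ℝ)).mul_const a).sub ((hasDerivAt_pow 2 (1 : ℝ)).mul_const b)).sub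
      ((Real.hasDerivAt_rpow_const (Or.inl one_ne_zero)).mul_const c)
  have h0 := hmax.hasDerivAt_eq_zero hder
  simp only [one_pow, Real.one_rpow] at h0
  push_cast at h0
  have h1 : a = 2 * b + p * c := by linarith
  have h2 : res Δs = b + (p - 1) * c := by
    rw [hres, ← ha, ← hb, ← hc, h1]
    ring
  refine ⟨h1, h2, fun ζ hζ => ?_⟩
  nlinarith [mul_nonneg (sub_nonneg.2 hp) hc0]
end

section
/- Let p ≥ 2 be a real number, g ∈ ℝ^n, R ∈ ℝ^(n×n) symmetric positive semidefinite, N ∈ ℝ^(m×n), A ∈ ℝ^(d×n), and res_p(Δ) = gᵀΔ − ΔᵀRΔ − ‖NΔ‖_p^p. Let ζ > 0 and suppose Δ* satisfies AΔ* = 0, res_p(Δ*) ≥ res_p(Δ) for all Δ with AΔ = 0, and ζ/2 < res_p(Δ*) ≤ ζ. Then: (i) there exists Δ with AΔ = 0, gᵀΔ = ζ/2 and ΔᵀRΔ + ‖NΔ‖_p^p ≤ 2ζ; (ii) for every a ≥ 1 and every Δ̃ with AΔ̃ = 0, gᵀΔ̃ = ζ/2, Δ̃ᵀRΔ̃ ≤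 a²ζ and ‖NΔ̃‖_p^p ≤ a^p·ζ, one has res_p(Δ̃/(5a²)) ≥ res_p(Δ*)/(100·a²). -/
open Matrix

theorem stmt_4 (p : ℝ) (hp : 2 ≤ p) (n m d : ℕ)
    (g : Fin n → ℝ) (R : Matrix (Fin n) (Fin n) ℝ) (hR : R.PosSemidef)
    (N : Matrix (Fin m) (Fin n) ℝ) (A : Matrix (Fin d) (Fin n) ℝ)
    (res : (Fin n → ℝ) → ℝ)
    (hres : ∀ Δ, res Δ = g ⬝ᵥ Δ - Δ ⬝ᵥ R.mulVec Δ - ∑ i, |N.mulVec Δ i| ^ p)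
    (ζ : ℝ) (hζ : 0 < ζ)
    (Δs : Fin n → ℝ) (hfeas : A.mulVec Δs = 0)
    (hopt : ∀ Δ, A.mulVec Δ = 0 → res Δ ≤ res Δs)
    (hlow : ζ / 2 < res Δs) (hhigh : res Δs ≤ ζ) :
    (∃ Δ : Fin n → ℝ, A.mulVec Δ = 0 ∧ g ⬝ᵥ Δ = ζ / 2 ∧
        Δ ⬝ᵥ R.mulVec Δ + (∑ i, |N.mulVec Δ i| ^ p) ≤ 2 * ζ) ∧
    ∀ a : ℝ, 1 ≤ a → ∀ Δt : Fin n → ℝ, A.mulVec Δt = 0 → g ⬝ᵥ Δt = ζ / 2 →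
      Δt ⬝ᵥ R.mulVec Δt ≤ a ^ 2 * ζ → (∑ i, |N.mulVec Δt i| ^ p) ≤ a ^ p * ζ →
      res Δs / (100 * a ^ 2) ≤ res ((1 / (5 * a ^ 2)) • Δt) := by
  have hQ : ∀ (t : ℝ) (x : Fin n → ℝ), (t • x) ⬝ᵥ R.mulVec (t • x) = t ^ 2 * (x ⬝ᵥ R.mulVec x) := by
    intro t x
    rw [Matrix.mulVec_smul, smul_dotProduct, dotProduct_smul, smul_eq_mul, smul_eq_mul]
    ring
  have hP : ∀ (t : ℝ) (x : Fin n → ℝ), 0 ≤ t →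
      (∑ i, |N.mulVec (t • x) i| ^ p) = t ^ p * ∑ i, |N.mulVec x i| ^ p := by
    intro t x ht
    rw [Matrix.mulVec_smul, Finset.mul_sum]
    refine Finset.sum_congr rfl fun i _ => ?_
    rw [Pi.smul_apply, smul_eq_mul, abs_mul, abs_of_nonneg ht, Real.mul_rpow ht (abs_nonneg _)]
  have hG : ∀ (t : ℝ) (x : Fin n → ℝ), g ⬝ᵥ (t • x) = t * (g ⬝ᵥ x) := by
    intro t x
    rw [dotProduct_smul, smul_eq_mul]
  have hA : ∀ (t : ℝ) (x : Fin n → ℝ), A.mulVec x = 0 → A.mulVec (t • x) = 0 := by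
    intro t x hx
    rw [Matrix.mulVec_smul, hx, smul_zero]
  have hQ0 : ∀ x : Fin n → ℝ, 0 ≤ x ⬝ᵥ R.mulVec x := by
    intro x
    simpa using hR.dotProduct_mulVec_nonneg x
  have hP0 : ∀ x : Fin n → ℝ, 0 ≤ ∑ i, |N.mulVec x i| ^ p :=
    fun x => Finset.sum_nonneg fun i _ => Real.rpow_nonneg (abs_nonneg _) _
  have hpow : ∀ t : ℝ, 0 < t → t ≤ 1 → t ^ p ≤ t ^ 2 := by
    intro t h0 h1
    have := Real.rpow_le_rpow_of_exponent_ge h0 h1 hp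
    simpa using this
  constructor
  · have h1 := hopt ((1 / 2 : ℝ) • Δs) (hA _ _ hfeas)
    rw [hres, hres, hG, hQ, hP _ _ (by norm_num)] at h1
    rw [hres] at hlow hhigh
    have hq := hQ0 Δs
    have hpp := hP0 Δs
    set G := g ⬝ᵥ Δs
    set Q := Δs ⬝ᵥ R.mulVec Δs
    set P := ∑ i, |N.mulVec Δs i| ^ p
    have h2 := mul_le_mul_of_nonneg_right (hpow (1 / 2) (by norm_num) (by norm_num)) hpp
    have hQP : Q + P ≤ 2 * ζ := by nlinarith
    have hGpos : 0 < G := by linarith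
    have hc0 : 0 < ζ / 2 / G := by positivity
    have hc1 : ζ / 2 / G ≤ 1 := by rw [div_le_one hGpos]; linarith
    refine ⟨(ζ / 2 / G) • Δs, hA _ _ hfeas, ?_, ?_⟩
    · rw [hG]; exact div_mul_cancel₀ _ hGpos.ne'
    · rw [hQ, hP _ _ hc0.le]
      have h3 : (ζ / 2 / G) ^ 2 ≤ 1 := pow_le_one₀ hc0.le hc1
      have h4 := (hpow _ hc0 hc1).trans h3
      have h5 := mul_le_mul_of_nonneg_right h3 hq
      have h6 := mul_le_mul_of_nonneg_right h4 hpp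
      linarith
  · intro a ha x _ hgx hqx hpx
    have ha0 : 0 < a := by linarith
    have hs0 : 0 < 1 / (5 * a ^ 2) := by positivity
    rw [hres ((1 / (5 * a ^ 2)) • x), hG, hQ, hP _ _ hs0.le, hgx]
    have h1 := mul_le_mul_of_nonneg_left hqx (sq_nonneg (1 / (5 * a ^ 2)))
    have h2 := mul_le_mul_of_nonneg_left hpx (Real.rpow_nonneg hs0.le p)
    have h3 : (1 / (5 * a ^ 2)) ^ p * a ^ p ≤ (1 / (5 * a)) ^ 2 := by
      rw [← Real.mul_rpow hs0.le ha0.le]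
      have : 1 / (5 * a ^ 2) * a = 1 / (5 * a) := by field_simp
      rw [this]
      refine hpow _ (by positivity) ?_
      rw [div_le_one (by positivity)]
      linarith
    have h4 := mul_le_mul_of_nonneg_right h3 hζ.le
    have h5 : (1 / (5 * a ^ 2)) ^ 2 * (a ^ 2 * ζ) = ζ / a ^ 2 / 25 := by field_simp; norm_num
    have h6 : (1 / (5 * a)) ^ 2 * ζ = ζ / a ^ 2 / 25 := by field_simp; norm_num
    have h7 : 1 / (5 * a ^ 2) * (ζ / 2) = ζ / a ^ 2 / 10 := by field_simp; norm_num
    have h8 : res Δs / (100 * a ^ 2) ≤ ζ / a ^ 2 / 100 := by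
      rw [div_div, mul_comm (a ^ 2)]
      gcongr
    have h9 : 0 < ζ / a ^ 2 := by positivity
    rw [h7]
    linarith
end

section
/- Let k ≥ 1 be a real number, A ∈ ℝ^(d×n), b ∈ ℝ^d, N ∈ ℝ^(m×n), and C ≥ 1. Suppose x*_k minimizes ‖Nx‖_k over {x : Ax = b}, x*_{2k} minimizes ‖Nx‖_{2k} over {x : Ax = b}, and x̃ satisfies Ax̃ = b and ‖Nx̃‖_k ≤ C·‖Nx*_k‖_k. Then ‖Nx*_{2k}‖_{2k}^{2k} ≤ ‖Nx̃‖_{2k}^{2k} ≤ C^{2k}·m·‖Nx*_{2k}‖_{2k}^{2k}; that is, x̃ is a (C^{2k}·m)-approximate solution in objective value to the 2k-norm problem. -/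
open Matrix

theorem stmt_5 (k : ℝ) (hk : 1 ≤ k) (d n m : ℕ)
    (A : Matrix (Fin d) (Fin n) ℝ) (b : Fin d → ℝ) (N : Matrix (Fin m) (Fin n) ℝ)
    (C : ℝ) (hC : 1 ≤ C)
    (xk x2k xt : Fin n → ℝ)
    (hxk : A.mulVec xk = b)
    (hxkopt : ∀ y, A.mulVec y = b →
      (∑ i, |N.mulVec xk i| ^ k) ^ (1 / k) ≤ (∑ i, |N.mulVec y i| ^ k) ^ (1 / k))
    (hx2k : A.mulVec x2k = b)
    (hx2kopt : ∀ y, A.mulVec y = b →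
      (∑ i, |N.mulVec x2k i| ^ (2 * k)) ^ (1 / (2 * k))
        ≤ (∑ i, |N.mulVec y i| ^ (2 * k)) ^ (1 / (2 * k)))
    (hxt : A.mulVec xt = b)
    (hxtapprox : (∑ i, |N.mulVec xt i| ^ k) ^ (1 / k)
        ≤ C * (∑ i, |N.mulVec xk i| ^ k) ^ (1 / k)) :
    (∑ i, |N.mulVec x2k i| ^ (2 * k)) ≤ (∑ i, |N.mulVec xt i| ^ (2 * k)) ∧
    (∑ i, |N.mulVec xt i| ^ (2 * k))
      ≤ C ^ (2 * k) * m * ∑ i, |N.mulVec x2k i| ^ (2 * k) := by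
  have hk0 : 0 < k := by linarith
  have hS : ∀ (p : ℝ) (v : Fin m → ℝ), 0 ≤ ∑ i, |v i| ^ p := fun p v =>
    Finset.sum_nonneg fun i _ => Real.rpow_nonneg (abs_nonneg _) _
  have hsq : ∀ t : ℝ, |t| ^ (2 * k) = (|t| ^ k) ^ 2 := fun t => by
    rw [mul_comm, Real.rpow_mul (abs_nonneg _), Real.rpow_two]
  have hCk : 0 ≤ C ^ k := Real.rpow_nonneg (by linarith) _
  have hC2 : C ^ (2 * k) = (C ^ k) ^ 2 := by
    rw [mul_comm, Real.rpow_mul (by linarith), Real.rpow_two]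
  refine ⟨(Real.rpow_le_rpow_iff (hS _ _) (hS _ _) (by positivity)).1 (hx2kopt xt hxt), ?_⟩
  have h1 : ∑ i, |N.mulVec xk i| ^ k ≤ ∑ i, |N.mulVec x2k i| ^ k :=
    (Real.rpow_le_rpow_iff (hS _ _) (hS _ _) (by positivity)).1 (hxkopt x2k hx2k)
  have h2 : ∑ i, |N.mulVec xt i| ^ k ≤ C ^ k * ∑ i, |N.mulVec xk i| ^ k := by
    have h := Real.rpow_le_rpow (Real.rpow_nonneg (hS _ _) _) hxtapprox hk0.le
    rw [Real.mul_rpow (by linarith) (Real.rpow_nonneg (hS _ _) _), ← Real.rpow_mul (hS _ _),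
      ← Real.rpow_mul (hS _ _), one_div_mul_cancel hk0.ne', Real.rpow_one, Real.rpow_one] at h
    exact h
  have h3 : ∑ i, |N.mulVec xt i| ^ k ≤ C ^ k * ∑ i, |N.mulVec x2k i| ^ k :=
    h2.trans (mul_le_mul_of_nonneg_left h1 hCk)
  simp only [hsq, hC2]
  calc ∑ i, (|N.mulVec xt i| ^ k) ^ 2 ≤ (∑ i, |N.mulVec xt i| ^ k) ^ 2 :=
        Finset.sum_sq_le_sq_sum_of_nonneg fun i _ => Real.rpow_nonneg (abs_nonneg _) _
    _ ≤ (C ^ k * ∑ i, |N.mulVec x2k i| ^ k) ^ 2 := pow_le_pow_left₀ (hS _ _) h3 2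
    _ = (C ^ k) ^ 2 * (∑ i, |N.mulVec x2k i| ^ k) ^ 2 := by ring
    _ ≤ (C ^ k) ^ 2 * (m * ∑ i, (|N.mulVec x2k i| ^ k) ^ 2) := by
        refine mul_le_mul_of_nonneg_left ?_ (by positivity)
        have h := sq_sum_le_card_mul_sum_sq (s := Finset.univ)
          (f := fun i => |N.mulVec x2k i| ^ k)
        simpa using h
    _ = _ := by ring
end

section
/- Let p ≥ 2 be a real number, N ∈ ℝ^(m×n), ζ > 0, and let w ∈ ℝ^m satisfy w_e ≥ 1 for every e; set r_e = w_e^(p−2). Suppose Δ̃, Δ* ∈ ℝ^n satisfy Σ_e r_e·(NΔ̃)_e² ≤ Σ_e r_e·(NΔ*)_e² and ‖NΔ*‖_p^p ≤ ζ. Then Σ_e (NΔ̃)_e² ≤ Σ_e r_e·(NΔ̃)_e² ≤ ζ^{2/p}·‖w‖_p^{p−2}. -/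
open Matrix

theorem stmt_6 (p : ℝ) (hp : 2 ≤ p) (m n : ℕ)
    (N : Matrix (Fin m) (Fin n) ℝ) (ζ : ℝ) (hζ : 0 < ζ)
    (w : Fin m → ℝ) (hw : ∀ e, 1 ≤ w e)
    (r : Fin m → ℝ) (hr : ∀ e, r e = w e ^ (p - 2))
    (Δt Δs : Fin n → ℝ)
    (h1 : ∑ e, r e * (N.mulVec Δt e) ^ 2 ≤ ∑ e, r e * (N.mulVec Δs e) ^ 2)
    (h2 : ∑ e, |N.mulVec Δs e| ^ p ≤ ζ) :
    (∑ e, (N.mulVec Δt e) ^ 2) ≤ (∑ e, r e * (N.mulVec Δt e) ^ 2) ∧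
    (∑ e, r e * (N.mulVec Δt e) ^ 2)
      ≤ ζ ^ (2 / p) * ((∑ e, |w e| ^ p) ^ (1 / p)) ^ (p - 2) := by
  have hsq : ∀ x : ℝ, x ^ 2 = |x| ^ (2 : ℝ) := fun x => by
    rw [Real.rpow_two, sq_abs]
  have hr1 : ∀ e, 1 ≤ r e := fun e => by
    rw [hr]; exact Real.one_le_rpow (hw e) (by linarith)
  refine ⟨Finset.sum_le_sum fun e _ => le_mul_of_one_le_left (sq_nonneg _) (hr1 e), h1.trans ?_⟩
  rcases hp.eq_or_lt with h | h
  · subst h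
    simp only [hr, hsq]
    simpa using h2
  · have hp0 : 0 < p := by linarith
    have hp2 : 0 < p - 2 := by linarith
    have hpq : (p / 2).HolderConjugate (p / (p - 2)) := by
      rw [Real.holderConjugate_iff]
      refine ⟨by linarith, ?_⟩
      field_simp
      ring
    have key := Real.inner_le_Lp_mul_Lq_of_nonneg Finset.univ
      (f := fun e => |N.mulVec Δs e| ^ (2 : ℝ)) (g := r) hpq
      (fun e _ => by positivity) (fun e _ => by linarith [hr1 e])
    have e1 : ∀ e, (|N.mulVec Δs e| ^ (2 : ℝ)) ^ (p / 2) = |N.mulVec Δs e| ^ p := fun e => by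
      rw [← Real.rpow_mul (abs_nonneg _)]; congr 1; field_simp
    have e2 : ∀ e, r e ^ (p / (p - 2)) = |w e| ^ p := fun e => by
      have hw0 : 0 ≤ w e := by linarith [hw e]
      rw [hr, ← Real.rpow_mul hw0, abs_of_nonneg hw0]; congr 1; field_simp
    simp only [e1, e2, one_div_div] at key
    have hW : 0 ≤ ∑ e, |w e| ^ p := Finset.sum_nonneg fun e _ => by positivity
    have hX : 0 ≤ ∑ e, |N.mulVec Δs e| ^ p := Finset.sum_nonneg fun e _ => by positivity
    rw [← Real.rpow_mul hW, one_div_mul_eq_div]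
    calc ∑ e, r e * (N.mulVec Δs e) ^ 2
        = ∑ e, |N.mulVec Δs e| ^ (2 : ℝ) * r e :=
          Finset.sum_congr rfl fun e _ => by rw [hsq, mul_comm]
      _ ≤ _ := key
      _ ≤ _ := mul_le_mul_of_nonneg_right
          (Real.rpow_le_rpow hX h2 (by positivity)) (Real.rpow_nonneg hW _)
end

section
/- Let p ∈ (1,2) be a real number and let x, Δ ∈ ℝ. Then |x|^p + p·|x|^(p−2)·x·Δ + ((p−1)/(p·2^p))·γ_p(|x|, Δ) ≤ |x + Δ|^p ≤ |x|^p + p·|x|^(p−2)·x·Δ + 2^p·γ_p(|x|, Δ), where |x|^(p−2)·x is interpreted as 0 when x = 0. -/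
lemma aux_mono (f f' : ℝ → ℝ) (h : ∀ u, HasDerivAt f (f' u) u) (a b : ℝ) (hab : a ≤ b)
    (h' : ∀ u, a < u → u < b → 0 ≤ f' u) : f a ≤ f b := by
  rcases hab.eq_or_lt with rfl | hlt
  · exact le_rfl
  obtain ⟨u, hu, he⟩ := exists_hasDerivAt_eq_slope f f' hlt
    (fun u _ => (h u).continuousAt.continuousWithinAt) (fun u _ => h u)
  have h1 := h' u hu.1 hu.2
  rw [he] at h1
  have h2 : 0 < b - a := sub_pos.2 hlt
  have := mul_nonneg h1 h2.le
  rw [div_mul_cancel₀ _ h2.ne'] at this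
  linarith

lemma aux_bern_s7 (q u : ℝ) (hq : 0 < q) (hq1 : q < 1) (hu : 0 ≤ u) :
    u ^ q ≤ 1 + q * (u - 1) := by
  have := rpow_one_add_le_one_add_mul_self (s := u - 1) (by linarith) hq.le hq1.le
  simpa using this

lemma aux_lowq (q u : ℝ) (hq : 0 < q) (hq1 : q < 1) (hu : 1 ≤ u) (hu2 : u ≤ 2) :
    1 + q / 2 * (u - 1) ≤ u ^ q := by
  have h := aux_bern_s7 q u⁻¹ hq hq1 (by positivity)
  rw [Real.inv_rpow (by linarith)] at h
  have hpos : 0 < u ^ q := Real.rpow_pos_of_pos (by linarith) _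
  have h1 : 1 ≤ (1 + q * (u⁻¹ - 1)) * u ^ q := by
    calc (1:ℝ) = (u ^ q)⁻¹ * u ^ q := by field_simp
      _ ≤ _ := by gcongr
  have h2 : u ≤ (u + q * (1 - u)) * u ^ q := by
    have e : (u + q * (1 - u)) * u ^ q = u * ((1 + q * (u⁻¹ - 1)) * u ^ q) := by
      field_simp
    rw [e]; nlinarith
  have h3 : 0 < u + q * (1 - u) := by nlinarith
  have h4 : (u + q * (1 - u)) * (1 + q / 2 * (u - 1)) ≤ u := by
    have : u - (u + q * (1 - u)) * (1 + q / 2 * (u - 1))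
        = q / 2 * (u - 1) * (2 - u + q * (u - 1)) := by ring
    have : 0 ≤ q / 2 * (u - 1) * (2 - u + q * (u - 1)) :=
      mul_nonneg (mul_nonneg (by linarith) (by linarith))
        (add_nonneg (by linarith) (mul_nonneg hq.le (by linarith)))
    linarith
  exact le_of_mul_le_mul_left (h4.trans h2) h3

lemma aux_small (p u : ℝ) (hp1 : 1 < p) (hp2 : p < 2) (hu : 0 ≤ u) (hu2 : u ≤ 2) :
    1 + p * (u - 1) + (p - 1) / 4 * (u - 1) ^ 2 ≤ u ^ p := by
  have hd : ∀ v : ℝ, HasDerivAt (fun v : ℝ => v ^ p - 1 - p * (v - 1) - (p - 1) / 4 * (v - 1) ^ 2)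
      (p * v ^ (p - 1) - p - (p - 1) / 2 * (v - 1)) v := by
    intro v
    have h1 := Real.hasDerivAt_rpow_const (x := v) (p := p) (Or.inr hp1.le)
    have h2 : HasDerivAt (fun v : ℝ => v - 1) 1 v := (hasDerivAt_id v).sub_const 1
    have := ((h1.sub_const 1).sub (h2.const_mul p)).sub ((h2.pow 2).const_mul ((p - 1) / 4))
    exact this.congr_deriv (by norm_num; try ring)
  rcases le_total 1 u with h | h
  · have := aux_mono _ _ hd 1 u h (fun v hv1 hv2 => by
      have := aux_lowq (p - 1) v (by linarith) (by linarith) hv1.le (by linarith)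
      have h0 : 0 ≤ (p - 1) / 2 * (v - 1) := mul_nonneg (by linarith) (by linarith)
      nlinarith)
    simp at this
    linarith
  · have := aux_mono _ _ (fun v => (hd v).neg) u 1 h (fun v hv1 hv2 => by
      have := aux_bern_s7 (p - 1) v (by linarith) (by linarith) (by linarith)
      have h0 : 0 ≤ (p - 1) * (1 - v) := mul_nonneg (by linarith) (by linarith)
      nlinarith)
    simp at this
    linarith

lemma aux_up (p u : ℝ) (hp1 : 1 < p) (hp2 : p < 2) (hu : 0 ≤ u) :
    u ^ p ≤ 1 + p * (u - 1) + (p - 1) * (u - 1) ^ 2 := by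
  have h := aux_bern_s7 (p - 1) u (by linarith) (by linarith) hu
  have e : u ^ p = u * u ^ (p - 1) := by
    rw [← Real.rpow_one_add' hu (by linarith)]; congr 1; ring
  rw [e]; nlinarith

/-- the normalized case `x = 1` -/
lemma aux_main (p : ℝ) (hp1 : 1 < p) (hp2 : p < 2) (s g : ℝ)
    (hg : g = if |s| ≤ 1 then p / 2 * s ^ 2 else |s| ^ p - (1 - p / 2)) :
    1 + p * s + (p - 1) / (p * (2 : ℝ) ^ p) * g ≤ |1 + s| ^ p ∧
    |1 + s| ^ p ≤ 1 + p * s + (2 : ℝ) ^ p * g := by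
  have hC2 : (2:ℝ) ≤ 2 ^ p := by
    simpa using Real.rpow_le_rpow_of_exponent_le (x := 2) (by norm_num) hp1.le
  have hCp : (2:ℝ) ^ p ≤ 2 * p := by
    have := aux_up p 2 hp1 hp2 (by norm_num)
    linarith
  have hCe : (2:ℝ) ^ p = 2 * 2 ^ (p - 1) := by
    rw [← Real.rpow_one_add' (by norm_num) (by linarith)]; congr 1; ring
  have hCl : 1 + (p - 1) / 2 ≤ (2:ℝ) ^ (p - 1) := by
    have := aux_lowq (p - 1) 2 (by linarith) (by linarith) (by norm_num) (by norm_num)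
    linarith
  have hCs : ∀ s : ℝ, 1 < s → (1 + s) ^ p ≤ (2:ℝ) ^ p * s ^ p := by
    intro s hs
    rw [← Real.mul_rpow (by norm_num) (by linarith)]
    exact Real.rpow_le_rpow (by linarith) (by linarith) (by linarith)
  obtain ⟨c, hc⟩ : ∃ c, c = (p - 1) / (p * (2 : ℝ) ^ p) := ⟨_, rfl⟩
  have hcC : c * (p * (2:ℝ) ^ p) = p - 1 := by
    rw [hc]; field_simp
  rw [← hc]
  have hc0 : 0 ≤ c := by
    rw [hc]; exact div_nonneg (by linarith) (by positivity)
  generalize (2:ℝ) ^ p = C at *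
  have hcp : c * p ≤ (p - 1) / 2 := by
    have := mul_le_mul_of_nonneg_left hC2 (mul_nonneg hc0 (by linarith : 0 ≤ p))
    linarith
  have hc1 : c ≤ (p - 1) / 2 := by nlinarith
  by_cases hs : |s| ≤ 1
  · rw [if_pos hs] at hg
    have ⟨h1, h2⟩ := abs_le.1 hs
    rw [abs_of_nonneg (by linarith : 0 ≤ 1 + s), hg]
    have hl := aux_small p (1 + s) hp1 hp2 (by linarith) (by linarith)
    have hu := aux_up p (1 + s) hp1 hp2 (by linarith)
    rw [add_sub_cancel_left] at hl hu
    have hs2 := sq_nonneg s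
    constructor
    · have := mul_le_mul_of_nonneg_right hcp hs2
      linarith
    · have := mul_le_mul_of_nonneg_right hC2 (mul_nonneg (by linarith : 0 ≤ p) hs2)
      linarith
  · rw [if_neg hs] at hg
    rw [not_le, lt_abs] at hs
    rw [hg]
    rcases hs with hs | hs
    · rw [abs_of_pos (by linarith : 0 < s), abs_of_pos (by linarith : 0 < 1 + s)]
      constructor
      · have hd : ∀ v : ℝ, HasDerivAt (fun v : ℝ => (1 + v) ^ p - 1 - p * v - c * (v ^ p - (1 - p / 2)))
            (p * (1 + v) ^ (p - 1) - p - c * (p * v ^ (p - 1))) v := by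
          intro v
          have h1 := Real.hasDerivAt_rpow_const (x := v) (p := p) (Or.inr hp1.le)
          have h3 := Real.hasDerivAt_rpow_const (x := 1 + v) (p := p) (Or.inr hp1.le)
          have h2 : HasDerivAt (fun v : ℝ => 1 + v) 1 v := (hasDerivAt_id v).const_add 1
          have h4 := h3.comp v h2
          have := ((h4.sub_const 1).sub ((hasDerivAt_id v).const_mul p)).sub
            ((h1.sub_const (1 - p / 2)).const_mul c)
          exact this.congr_deriv (by norm_num; try ring)
        have := aux_mono _ _ hd 1 s hs.le (fun v hv1 hv2 => by
          have ha : v ^ (p - 1) ≤ (1 + v) ^ (p - 1) :=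
            Real.rpow_le_rpow (by linarith) (by linarith) (by linarith)
          have hb : (2:ℝ) ^ (p - 1) ≤ (1 + v) ^ (p - 1) :=
            Real.rpow_le_rpow (by norm_num) (by linarith) (by linarith)
          have h1 := mul_le_mul_of_nonneg_left ha hc0
          have h2 : (1 - c) * (2:ℝ) ^ (p - 1) ≤ (1 - c) * (1 + v) ^ (p - 1) :=
            mul_le_mul_of_nonneg_left hb (by linarith)
          have h3 : c * (2:ℝ) ^ (p - 1) ≤ (p - 1) / 2 := by
            rw [hCe] at hcC
            have : 0 ≤ c * (2:ℝ) ^ (p - 1) := by positivity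
            nlinarith
          have h4 : 0 ≤ (1 + v) ^ (p - 1) - 1 - c * v ^ (p - 1) := by linarith
          have := mul_nonneg (by linarith : 0 ≤ p) h4
          linarith)
        have hl := aux_small p (1 + 1) hp1 hp2 (by linarith) (by linarith)
        simp only [Real.one_rpow] at this
        linarith
      · have h1 : (1 + s) ^ p ≤ C * s ^ p := by
          exact hCs s hs
        have : C * (1 - p / 2) ≤ 2 * p * (1 - p / 2) :=
          mul_le_mul_of_nonneg_right hCp (by linarith)
        nlinarith [sq_nonneg (p - 1)]
    · obtain ⟨r, rfl⟩ : ∃ r, s = -r := ⟨-s, by ring⟩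
      rw [neg_neg] at hs
      rw [abs_neg, abs_of_pos (by linarith : 0 < r), abs_of_neg (by linarith : 1 + -r < 0),
        show -(1 + -r) = r - 1 by ring]
      constructor
      · have hd : ∀ v : ℝ, HasDerivAt (fun v : ℝ => (v - 1) ^ p - 1 + p * v - c * (v ^ p - (1 - p / 2)))
            (p * (v - 1) ^ (p - 1) + p - c * (p * v ^ (p - 1))) v := by
          intro v
          have h1 := Real.hasDerivAt_rpow_const (x := v) (p := p) (Or.inr hp1.le)
          have h3 := Real.hasDerivAt_rpow_const (x := v - 1) (p := p) (Or.inr hp1.le)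
          have h2 : HasDerivAt (fun v : ℝ => v - 1) 1 v := (hasDerivAt_id v).sub_const 1
          have h4 := h3.comp v h2
          have := ((h4.sub_const 1).add ((hasDerivAt_id v).const_mul p)).sub
            ((h1.sub_const (1 - p / 2)).const_mul c)
          exact this.congr_deriv (by norm_num; try ring)
        have := aux_mono _ _ hd 1 r hs.le (fun v hv1 hv2 => by
          have ha : v ^ (p - 1) ≤ (v - 1) ^ (p - 1) + 1 := by
            have := Real.rpow_add_le_add_rpow (a := v - 1) (b := 1) (p := p - 1) (by linarith) (by linarith) (by linarith) (by linarith)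
            simpa using this
          have h1 : c * v ^ (p - 1) ≤ 1 * v ^ (p - 1) :=
            mul_le_mul_of_nonneg_right (by linarith) (Real.rpow_nonneg (by linarith) _)
          have h4 : 0 ≤ (v - 1) ^ (p - 1) + 1 - c * v ^ (p - 1) := by linarith
          have := mul_nonneg (by linarith : 0 ≤ p) h4
          linarith)
        simp only [Real.one_rpow, sub_self, Real.zero_rpow (by linarith : p ≠ 0)] at this
        linarith
      · have h1 : (r - 1) ^ p ≤ r ^ p - 1 := by
          have := Real.add_rpow_le_rpow_add (a := r - 1) (b := 1) (p := p) (by linarith) (by linarith) hp1.le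
          simp at this
          linarith
        have h2 : 1 + p * (r - 1) ≤ r ^ p := by
          have := one_add_mul_self_le_rpow_one_add (s := r - 1) (by linarith) hp1.le
          simpa using this
        have h3 := mul_le_mul_of_nonneg_left h2 (by linarith : 0 ≤ C - 1)
        have h4 : 0 ≤ (C - 2) * (p * (r - 1)) :=
          mul_nonneg (by linarith) (mul_nonneg (by linarith) (by linarith))
        have h5 := mul_le_mul_of_nonneg_right hC2 (by linarith : 0 ≤ p)
        linarith

theorem stmt_7 (p : ℝ) (hp1 : 1 < p) (hp2 : p < 2) (x Δ : ℝ)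
    (γ : ℝ → ℝ → ℝ)
    (hγ : ∀ t z, γ t z = if |z| ≤ t then p / 2 * t ^ (p - 2) * z ^ 2
        else |z| ^ p - (1 - p / 2) * t ^ p) :
    |x| ^ p + p * (|x| ^ (p - 2) * x) * Δ + (p - 1) / (p * (2 : ℝ) ^ p) * γ |x| Δ
      ≤ |x + Δ| ^ p ∧
    |x + Δ| ^ p
      ≤ |x| ^ p + p * (|x| ^ (p - 2) * x) * Δ + (2 : ℝ) ^ p * γ |x| Δ := by
  have hC2 : (2:ℝ) ≤ 2 ^ p := by
    simpa using Real.rpow_le_rpow_of_exponent_le (x := 2) (by norm_num) hp1.le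
  have hp0 : p ≠ 0 := by linarith
  by_cases hx : x = 0
  · subst hx
    have hg : γ |0| Δ = |Δ| ^ p := by
      rw [hγ]
      split_ifs with h
      · have : Δ = 0 := by simpa using h
        simp [this, Real.zero_rpow hp0]
      · simp [Real.zero_rpow hp0]
    rw [hg]
    have hn : 0 ≤ |Δ| ^ p := by positivity
    simp only [abs_zero, Real.zero_rpow hp0, mul_zero, zero_mul, zero_add]
    constructor
    · have : (p - 1) / (p * (2 : ℝ) ^ p) ≤ 1 := by
        rw [div_le_one (by positivity)]; nlinarith
      nlinarith
    · nlinarith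
  · obtain ⟨s, rfl⟩ : ∃ s, Δ = x * s := ⟨Δ / x, by field_simp⟩
    have hx0 : 0 < |x| := abs_pos.2 hx
    have e2 : |x| ^ (p - 2) * x ^ 2 = |x| ^ p := by
      rw [← sq_abs x, ← Real.rpow_natCast, ← Real.rpow_add hx0]; congr 1; norm_num
    have hg : γ |x| (x * s) = |x| ^ p * (if |s| ≤ 1 then p / 2 * s ^ 2 else |s| ^ p - (1 - p / 2)) := by
      rw [hγ, abs_mul]
      have : |x| * |s| ≤ |x| ↔ |s| ≤ 1 := by
        constructor
        · intro h; nlinarith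
        · intro h; nlinarith
      simp only [this]
      split_ifs
      · rw [← e2]; ring
      · rw [Real.mul_rpow (abs_nonneg _) (abs_nonneg _)]; ring
    have ⟨h1, h2⟩ := aux_main p hp1 hp2 s _ rfl
    have e1 : |x + x * s| ^ p = |x| ^ p * |1 + s| ^ p := by
      rw [← Real.mul_rpow (abs_nonneg _) (abs_nonneg _), ← abs_mul]; congr 2; ring
    have e3 : p * (|x| ^ (p - 2) * x) * (x * s) = |x| ^ p * (p * s) := by
      rw [← e2]; ring
    rw [hg, e1, e3]
    have hn : 0 ≤ |x| ^ p := by positivity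
    have h1 := mul_le_mul_of_nonneg_left h1 hn
    have h2 := mul_le_mul_of_nonneg_left h2 hn
    constructor <;> linarith
end

section
/- Let p ∈ (1,2) be a real number. For every real α with |α| ≤ 1, 1 + α·p + ((p−1)/4)·α² ≤ (1+α)^p ≤ 1 + α·p + p·2^(p−1)·α². -/
theorem bern_aux (r x : ℝ) (h0 : 0 ≤ r) (h1 : r ≤ 1) (hx : -1 ≤ x) :
    (1 + x) ^ r ≤ 1 + r * x := rpow_one_add_le_one_add_mul_self hx h0 h1

theorem lower_aux (p : ℝ) (hp1 : 1 < p) (hp2 : p < 2) (α : ℝ) (hl : -1 ≤ α) (hu : α ≤ 1) :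
    1 + α * p + (p - 1) / 4 * α ^ 2 ≤ (1 + α) ^ p := by
  let f : ℝ → ℝ := fun x => (1 + x) ^ p - (1 + x * p + (p - 1) / 4 * x ^ 2)
  have hd : ∀ x, HasDerivAt f (p * (1 + x) ^ (p - 1) - (p + (p - 1) / 2 * x)) x := by
    intro x
    have h1 : HasDerivAt (fun x : ℝ => (1 + x) ^ p) (p * (1 + x) ^ (p - 1)) x := by
      have := ((hasDerivAt_id x).const_add 1).rpow_const (p := p) (Or.inr hp1.le)
      simpa using this
    have h2 : HasDerivAt (fun x : ℝ => 1 + x * p + (p - 1) / 4 * x ^ 2)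
        (p + (p - 1) / 2 * x) x := by
      have := (((hasDerivAt_id x).mul_const p).const_add 1).add
        (((hasDerivAt_id x).pow 2).const_mul ((p - 1) / 4))
      refine HasDerivAt.congr_deriv this ?_
      simp only [id, Nat.cast_ofNat, Nat.add_one_sub_one, pow_one]
      ring
    exact h1.sub h2
  have hc : Continuous f := continuous_iff_continuousAt.2 fun x => (hd x).continuousAt
  have hf0 : f 0 = 0 := by simp [f]
  suffices h : f 0 ≤ f α by
    rw [hf0] at h
    exact sub_nonneg.1 h
  rcases le_total 0 α with h0 | h0
  · have hm : MonotoneOn f (Set.Icc 0 1) := by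
      apply monotoneOn_of_deriv_nonneg (convex_Icc 0 1) hc.continuousOn
      · exact fun x _ => (hd x).differentiableAt.differentiableWithinAt
      · intro x hx
        rw [interior_Icc] at hx
        obtain ⟨hx0, hx1⟩ := hx
        rw [(hd x).deriv]
        have hb := bern_aux (2 - p) x (by linarith) (by linarith) (by linarith)
        have hprod : (1 + x) ^ (p - 1) * (1 + x) ^ (2 - p) = 1 + x := by
          rw [← Real.rpow_add (by linarith)]
          norm_num
        have hpos : 0 < (1 + x) ^ (p - 1) := Real.rpow_pos_of_pos (by linarith) _
        have h3 : 1 + x ≤ (1 + x) ^ (p - 1) * (1 + (2 - p) * x) := by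
          have := mul_le_mul_of_nonneg_left hb hpos.le
          linarith
        have h4 : 0 < 1 + (2 - p) * x := by nlinarith
        have h5 : (p + (p - 1) / 2 * x) * (1 + (2 - p) * x) ≤ p * (1 + x) := by
          have : p * (1 + x) - (p + (p - 1) / 2 * x) * (1 + (2 - p) * x)
            = (p - 1) * x / 2 * (2 * p - 1 - (2 - p) * x) := by ring
          have h6 : 0 ≤ (p - 1) * x / 2 := by
            have := mul_pos (sub_pos.2 hp1) hx0
            linarith
          have h7 : 0 ≤ 2 * p - 1 - (2 - p) * x := by nlinarith
          have := mul_nonneg h6 h7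
          linarith
        have h8 : (p + (p - 1) / 2 * x) ≤ p * (1 + x) ^ (p - 1) := by
          apply le_of_mul_le_mul_right _ h4
          nlinarith
        linarith
    exact hm ⟨le_rfl, zero_le_one⟩ ⟨h0, hu⟩ h0
  · have hm : AntitoneOn f (Set.Icc (-1) 0) := by
      apply antitoneOn_of_deriv_nonpos (convex_Icc (-1) 0) hc.continuousOn
      · exact fun x _ => (hd x).differentiableAt.differentiableWithinAt
      · intro x hx
        rw [interior_Icc] at hx
        obtain ⟨hx0, hx1⟩ := hx
        rw [(hd x).deriv]
        have hb := bern_aux (p - 1) x (by linarith) (by linarith) (by linarith)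
        have h1 := mul_le_mul_of_nonneg_left hb (by linarith : 0 ≤ p)
        have h2 : (p - 1) * x ≤ 0 := by nlinarith
        nlinarith
    exact hm ⟨hl, h0⟩ ⟨by norm_num, le_rfl⟩ h0

theorem stmt_8 (p : ℝ) (hp1 : 1 < p) (hp2 : p < 2) (α : ℝ) (hα : |α| ≤ 1) :
    1 + α * p + (p - 1) / 4 * α ^ 2 ≤ (1 + α) ^ p ∧
    (1 + α) ^ p ≤ 1 + α * p + p * (2 : ℝ) ^ (p - 1) * α ^ 2 := by
  obtain ⟨hl, hu⟩ := abs_le.1 hα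
  refine ⟨lower_aux p hp1 hp2 α hl hu, ?_⟩
  have hb := bern_aux (p - 1) α (by linarith) (by linarith) hl
  have h1 : (1 + α) ^ p = (1 + α) * (1 + α) ^ (p - 1) := by
    have := Real.rpow_add' (x := 1 + α) (y := 1) (z := p - 1) (by linarith) (by linarith)
    rw [Real.rpow_one] at this
    rw [← this]
    congr 1
    ring
  have h2 : (1 : ℝ) ≤ 2 ^ (p - 1) := Real.one_le_rpow (by norm_num) (by linarith)
  have h3 := mul_le_mul_of_nonneg_left hb (by linarith : 0 ≤ 1 + α)
  have h4 : p - 1 ≤ p * (2 : ℝ) ^ (p - 1) := by nlinarith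
  have h5 := mul_le_mul_of_nonneg_right h4 (sq_nonneg α)
  rw [h1]
  nlinarith
end

section
/- Let p ∈ (1,2) be a real number, t ≥ 0, z ∈ ℝ, and λ ≥ 0. Then γ_p(t, λ·z) ≥ min(λ², λ^p)·γ_p(t, z). -/
/-- Bernoulli for concave powers, written for squares. -/
lemma bern_sq (x r : ℝ) (hx : 0 ≤ x) (h0 : 0 ≤ r) (h1 : r ≤ 2) :
    x ^ r ≤ 1 + r / 2 * (x ^ 2 - 1) := by
  have h := rpow_one_add_le_one_add_mul_self (s := x ^ 2 - 1) (p := r / 2)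
    (by nlinarith [sq_nonneg x]) (by linarith) (by linarith)
  have e : (1 + (x ^ 2 - 1)) ^ (r / 2) = x ^ r := by
    rw [show 1 + (x ^ 2 - 1) = x ^ (2 : ℝ) by rw [Real.rpow_two]; ring, ← Real.rpow_mul hx]
    congr 1; ring
  rwa [e] at h

lemma norm_case (p : ℝ) (hp1 : 1 < p) (hp2 : p < 2) (x l : ℝ) (hx : 0 ≤ x) (hl : 0 ≤ l)
    (g : ℝ → ℝ) (hg : ∀ x, g x = if x ≤ 1 then p / 2 * x ^ 2 else x ^ p - (1 - p / 2)) :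
    min (l ^ 2) (l ^ p) * g x ≤ g (l * x) := by
  have hm1 := min_le_left (l ^ 2) (l ^ p)
  have hm2 := min_le_right (l ^ 2) (l ^ p)
  set m := min (l ^ 2) (l ^ p)
  rw [hg, hg]
  have split : ∀ y : ℝ, 0 < y → y ^ p * y ^ (2 - p) = y ^ 2 := fun y hy => by
    rw [← Real.rpow_add hy, ← Real.rpow_two]; congr 1; ring
  split_ifs with h1 h2 h2
  · have : m * (p / 2 * x ^ 2) ≤ l ^ 2 * (p / 2 * x ^ 2) := by gcongr
    nlinarith
  · have hlx : 1 < l * x := not_le.1 h2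
    have hx0 : 0 < x := by
      rcases hx.eq_or_lt with h | h
      · subst h; simp at hlx; linarith
      · exact h
    have a1 : m * (p / 2 * x ^ 2) ≤ l ^ p * (p / 2 * x ^ 2) := by gcongr
    have a2 : 1 ≤ (l * x) ^ p := Real.one_le_rpow hlx.le (by linarith)
    have a3 : x ^ (2 - p) ≤ 1 := Real.rpow_le_one hx h1 (by linarith)
    have a4 := split x hx0
    rw [Real.mul_rpow hl hx] at a2 ⊢
    rw [← a4] at a1 ⊢
    have a5 : 0 ≤ x ^ (2 - p) := by positivity
    have a6 : 0 ≤ (l ^ p * x ^ p) * (1 - x ^ (2 - p)) :=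
      mul_nonneg (by linarith) (by linarith)
    nlinarith
  · have hx1 : 1 < x := not_le.1 h1
    have b := bern_sq x p hx (by linarith) hp2.le
    have c : 1 ≤ x ^ p := Real.one_le_rpow hx1.le (by linarith)
    have : m * (x ^ p - (1 - p / 2)) ≤ l ^ 2 * (x ^ p - (1 - p / 2)) :=
      mul_le_mul_of_nonneg_right hm1 (by linarith)
    have : l ^ 2 * (x ^ p - (1 - p / 2)) ≤ l ^ 2 * (p / 2 * x ^ 2) :=
      mul_le_mul_of_nonneg_left (by linarith) (by positivity)
    nlinarith
  · have hx1 : 1 < x := not_le.1 h1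
    have hlx : 1 < l * x := not_le.1 h2
    have c : 1 ≤ x ^ p := Real.one_le_rpow hx1.le (by linarith)
    have a2 : 1 ≤ (l * x) ^ p := Real.one_le_rpow hlx.le (by linarith)
    rw [Real.mul_rpow hl hx] at a2 ⊢
    rcases le_total 1 l with h | h
    · have d : 1 ≤ l ^ p := Real.one_le_rpow h (by linarith)
      have : m * (x ^ p - (1 - p / 2)) ≤ l ^ p * (x ^ p - (1 - p / 2)) :=
        mul_le_mul_of_nonneg_right hm2 (by linarith)
      nlinarith
    · have hl0 : 0 < l := by
        rcases hl.eq_or_lt with h | h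
        · subst h; simp at hlx; linarith
        · exact h
      have : m * (x ^ p - (1 - p / 2)) ≤ l ^ 2 * (x ^ p - (1 - p / 2)) :=
        mul_le_mul_of_nonneg_right hm1 (by linarith)
      have b := bern_sq l (2 - p) hl (by linarith) (by linarith)
      have a3 : l ^ (2 - p) ≤ 1 := Real.rpow_le_one hl h (by linarith)
      have a6 : 0 ≤ (l ^ p * x ^ p - 1) * (1 - l ^ (2 - p)) :=
        mul_nonneg (by linarith) (by linarith)
      have a4 := split l hl0
      have a7 : l ^ 2 * x ^ p = l ^ p * x ^ p * l ^ (2 - p) := by rw [← a4]; ring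
      nlinarith

theorem stmt_10 (p : ℝ) (hp1 : 1 < p) (hp2 : p < 2)
    (t : ℝ) (ht : 0 ≤ t) (z : ℝ) (lam : ℝ) (hlam : 0 ≤ lam)
    (γ : ℝ → ℝ → ℝ)
    (hγ : ∀ t z, γ t z = if |z| ≤ t then p / 2 * t ^ (p - 2) * z ^ 2
        else |z| ^ p - (1 - p / 2) * t ^ p) :
    min (lam ^ 2) (lam ^ p) * γ t z ≤ γ t (lam * z) := by
  have hp0 : p ≠ 0 := by linarith
  rcases ht.eq_or_lt with h | h
  · subst h
    have e : ∀ z, γ 0 z = |z| ^ p := fun z => by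
      rw [hγ]
      split_ifs with h
      · have : z = 0 := abs_nonpos_iff.1 h
        subst this; simp [Real.zero_rpow hp0]
      · simp [Real.zero_rpow hp0]
    rw [e, e, abs_mul, abs_of_nonneg hlam, Real.mul_rpow hlam (abs_nonneg z)]
    exact mul_le_mul_of_nonneg_right (min_le_right _ _) (by positivity)
  · have e : ∀ z, γ t z = t ^ p * (fun x : ℝ => if x ≤ 1 then p / 2 * x ^ 2
        else x ^ p - (1 - p / 2)) (|z| / t) := fun z => by
      rw [hγ]
      simp only [div_le_one h]
      split_ifs with h1
      · rw [Real.rpow_sub h, Real.rpow_two, div_pow, sq_abs]; ring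
      · rw [Real.div_rpow (abs_nonneg z) ht]
        have : t ^ p ≠ 0 := by positivity
        field_simp
    have k := norm_case p hp1 hp2 (|z| / t) lam (by positivity) hlam _ (fun x => rfl)
    rw [e, e, abs_mul, abs_of_nonneg hlam, mul_div_assoc, mul_left_comm]
    exact mul_le_mul_of_nonneg_left k (by positivity)
end

section
/- Let p ∈ (1,2) be a real number and let λ > 0 satisfy λ^(p−1) = p·4^p/(p−1). Let N ∈ ℝ^(m×n), x ∈ ℝ^n, set g = p·Nᵀ(|Nx|^(p−2) ⊙ (Nx)) ∈ ℝ^n (with entries |（Nx)_i|^(p−2)·(Nx)_i interpreted as 0 where (Nx)_i = 0), and define res_p(Δ) = gᵀΔ − 2^p·γ_p(|Nx|, NΔ). Then for every Δ ∈ ℝ^n: (i) res_p(Δ) ≤ ‖Nx‖_p^p − ‖N(x−Δ)‖_p^p, and (ii) ‖Nx‖_p^p − ‖N(x−λΔ)‖_p^p ≤ λ·res_p(Δ). -/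
open Matrix

noncomputable def Gam (p s : ℝ) : ℝ :=
  if |s| ≤ 1 then p / 2 * s ^ 2 else |s| ^ p - (1 - p / 2)

lemma two_rpow_bounds (p : ℝ) (hp1 : 1 < p) (hp2 : p < 2) :
    2 ≤ (2:ℝ) ^ p ∧ (2:ℝ) ^ p ≤ 2 * p := by
  constructor
  · have := Real.rpow_le_rpow_of_exponent_le (x := 2) (by norm_num) hp1.le
    simpa using this
  · have h := rpow_one_add_le_one_add_mul_self (s := 1) (by norm_num) (p := p - 1)
      (by linarith) (by linarith)
    have e : (2:ℝ) ^ p = 2 * (1 + 1) ^ (p - 1) := by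
      norm_num
      rw [Real.rpow_sub_one (by norm_num)]; ring
    rw [e]; linarith

lemma upper (p : ℝ) (hp1 : 1 < p) (hp2 : p < 2) (s : ℝ) :
    |1 + s| ^ p ≤ 1 + p * s + 2 ^ p * Gam p s := by
  obtain ⟨h2, h2'⟩ := two_rpow_bounds p hp1 hp2
  unfold Gam
  split_ifs with h
  · rw [abs_le] at h
    have h0 : 0 ≤ 1 + s := by linarith
    have hb := rpow_one_add_le_one_add_mul_self (s := s) h.1 (p := p - 1)
      (by linarith) (by linarith)
    rw [abs_of_nonneg h0]
    have e : (1 + s) ^ p = (1 + s) * (1 + s) ^ (p - 1) := by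
      rw [← Real.rpow_one_add' h0 (by linarith)]; congr 1; ring
    rw [e]
    have h3 := mul_le_mul_of_nonneg_left hb h0
    have h4 : 0 ≤ (2 ^ p - 2) * (p / 2 * s ^ 2) :=
      mul_nonneg (by linarith) (by positivity)
    nlinarith [sq_nonneg s]
  · rcases le_or_gt 0 s with hs | hs
    · rw [abs_of_nonneg hs] at h ⊢
      push Not at h
      rw [abs_of_nonneg (by linarith)]
      have h3 : (1 + s) ^ p ≤ (2 * s) ^ p :=
        Real.rpow_le_rpow (by linarith) (by linarith) (by linarith)
      rw [Real.mul_rpow (by norm_num) hs] at h3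
      have h4 : (2:ℝ) ^ p * (1 - p / 2) ≤ 2 * p * (1 - p / 2) :=
        mul_le_mul_of_nonneg_right h2' (by linarith)
      nlinarith [sq_nonneg (p - 1)]
    · rw [abs_of_neg hs] at h ⊢
      push Not at h
      obtain ⟨u, rfl⟩ : ∃ u, s = -u := ⟨-s, by ring⟩
      rw [neg_neg] at h ⊢
      have hab : |1 + -u| = u - 1 := by rw [abs_of_neg (by linarith)]; ring
      rw [hab]
      have h0 : 0 ≤ u - 1 := by linarith
      have h3 : (u - 1) ^ p ≤ u ^ p - u ^ (p - 1) := by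
        have e : (u - 1) ^ p = (u - 1) * (u - 1) ^ (p - 1) := by
          rw [← Real.rpow_one_add' h0 (by linarith)]; congr 1; ring
        have e2 : u ^ p = u * u ^ (p - 1) := by
          rw [← Real.rpow_one_add' (by linarith) (by linarith)]; congr 1; ring
        have h5 : (u - 1) ^ (p - 1) ≤ u ^ (p - 1) :=
          Real.rpow_le_rpow h0 (by linarith) (by linarith)
        have h6 := mul_le_mul_of_nonneg_left h5 h0
        rw [e, e2]; linarith
      have h4 := one_add_mul_self_le_rpow_one_add (s := u - 1) (by linarith) hp1.le
      rw [add_sub_cancel] at h4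
      have h5 : 0 ≤ u ^ (p - 1) := Real.rpow_nonneg (by linarith) _
      have h6 : 2 * (u ^ p - (1 - p / 2)) ≤ 2 ^ p * (u ^ p - (1 - p / 2)) :=
        mul_le_mul_of_nonneg_right h2 (by nlinarith)
      nlinarith

lemma pow_tangent (q : ℝ) (hq0 : 0 < q) (hq1 : q < 1) (M y : ℝ) (hM : 1 ≤ M) (hy : 1 ≤ y)
    (hyM : y ≤ M) : q * M ^ (q - 1) * (y - 1) ≤ y ^ q - 1 := by
  have hy0 : 0 < y := by linarith
  have h := rpow_one_add_le_one_add_mul_self (s := y⁻¹ - 1)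
    (by have : 0 < y⁻¹ := by positivity
        linarith) hq0.le hq1.le
  rw [add_sub_cancel, Real.inv_rpow hy0.le] at h
  have hyq : 0 < y ^ q := by positivity
  have h2 := mul_le_mul_of_nonneg_left h hyq.le
  rw [mul_inv_cancel₀ hyq.ne'] at h2
  have e : y ^ (q - 1) = y ^ q * y⁻¹ := by rw [Real.rpow_sub_one hy0.ne']; rfl
  have h3 : M ^ (q - 1) ≤ y ^ (q - 1) :=
    Real.rpow_le_rpow_of_nonpos hy0 hyM (by linarith)
  have h4 : q * M ^ (q - 1) * (y - 1) ≤ q * y ^ (q - 1) * (y - 1) := by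
    apply mul_le_mul_of_nonneg_right _ (by linarith)
    exact mul_le_mul_of_nonneg_left h3 hq0.le
  have e3 : y ^ q * y⁻¹ * y = y ^ q := by field_simp
  have e2 : q * y ^ (q - 1) * (y - 1) = q * y ^ q - q * (y ^ q * y⁻¹) := by
    rw [e]; linear_combination q * e3
  nlinarith

lemma strong (p : ℝ) (hp1 : 1 < p) (hp2 : p < 2) (M y : ℝ) (hM : 1 ≤ M) (hy : 0 ≤ y)
    (hyM : y ≤ M) :
    p * (p - 1) / 2 * M ^ (p - 2) * (y - 1) ^ 2 ≤ y ^ p - 1 - p * (y - 1) := by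
  set K := p * (p - 1) / 2 * M ^ (p - 2) with hK
  let f : ℝ → ℝ := fun y => y ^ p - 1 - p * (y - 1) - K * (y - 1) ^ 2
  have hd : ∀ y : ℝ, HasDerivAt f (p * y ^ (p - 1) - p - 2 * K * (y - 1)) y := by
    intro y
    have h1 := Real.hasDerivAt_rpow_const (x := y) (p := p) (Or.inr hp1.le)
    have h2 := ((hasDerivAt_id y).sub_const 1)
    have h3 := (((h1.sub_const 1).sub (h2.const_mul p)).sub ((h2.pow 2).const_mul K))
    refine h3.congr_deriv ?_
    simp; ring
  have hc : Continuous f := continuous_iff_continuousAt.2 fun y => (hd y).continuousAt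
  have hf1 : f 1 = 0 := by simp [f]
  suffices 0 ≤ f y by simp only [f] at this; linarith
  rcases le_total 1 y with h | h
  · have : MonotoneOn f (Set.Icc 1 M) := by
      apply monotoneOn_of_deriv_nonneg (convex_Icc 1 M) hc.continuousOn
      · intro z _; exact (hd z).differentiableAt.differentiableWithinAt
      · intro z hz
        rw [interior_Icc] at hz
        rw [(hd z).deriv]
        have := pow_tangent (p - 1) (by linarith) (by linarith) M z hM hz.1.le hz.2.le
        have e : p - 1 - 1 = p - 2 := by ring
        rw [e] at this
        have := mul_le_mul_of_nonneg_left this (show 0 ≤ p by linarith)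
        rw [hK]; linarith
    rw [← hf1]
    exact this ⟨le_rfl, hM⟩ ⟨h, hyM⟩ h
  · have : AntitoneOn f (Set.Icc 0 1) := by
      apply antitoneOn_of_deriv_nonpos (convex_Icc 0 1) hc.continuousOn
      · intro z _; exact (hd z).differentiableAt.differentiableWithinAt
      · intro z hz
        rw [interior_Icc] at hz
        rw [(hd z).deriv]
        have h1 := rpow_one_add_le_one_add_mul_self (s := z - 1) (by linarith [hz.1])
          (p := p - 1) (by linarith) (by linarith)
        rw [add_sub_cancel] at h1
        have h2 : M ^ (p - 2) ≤ 1 := Real.rpow_le_one_of_one_le_of_nonpos hM (by linarith)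
        have h3 : 2 * K ≤ p * (p - 1) := by
          have : p * (p - 1) * M ^ (p - 2) ≤ p * (p - 1) * 1 :=
            mul_le_mul_of_nonneg_left h2 (mul_nonneg (by linarith) (by linarith))
          rw [hK]; linarith
        have h4 := mul_le_mul_of_nonneg_right h3 (show 0 ≤ 1 - z by linarith [hz.2])
        have h5 := mul_le_mul_of_nonneg_left h1 (show 0 ≤ p by linarith)
        linarith
    rw [← hf1]
    exact this ⟨hy, h⟩ ⟨by norm_num, le_rfl⟩ h

lemma large (p : ℝ) (hp1 : 1 < p) (hp2 : p < 2) (c : ℝ) (hc0 : 0 ≤ c) (hc : c ≤ (p - 1) / 2)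
    (s : ℝ) (hs : 1 ≤ s) :
    2 ^ p - p - c ≤ (1 + s) ^ p - p * s - c * s ^ p := by
  let f : ℝ → ℝ := fun y => (1 + y) ^ p - p * y - c * y ^ p
  have hd : ∀ y : ℝ, HasDerivAt f (p * (1 + y) ^ (p - 1) - p - c * (p * y ^ (p - 1))) y := by
    intro y
    have h1 := Real.hasDerivAt_rpow_const (x := y) (p := p) (Or.inr hp1.le)
    have h2 := ((hasDerivAt_id y).const_add 1).rpow_const (p := p) (Or.inr hp1.le)
    have h3 := (h2.sub ((hasDerivAt_id y).const_mul p)).sub (h1.const_mul c)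
    refine h3.congr_deriv ?_
    simp
  have hcf : Continuous f := continuous_iff_continuousAt.2 fun y => (hd y).continuousAt
  have hf1 : f 1 = 2 ^ p - p - c := by simp [f]; norm_num
  have : MonotoneOn f (Set.Ici 1) := by
    apply monotoneOn_of_deriv_nonneg (convex_Ici 1) hcf.continuousOn
    · intro z _; exact (hd z).differentiableAt.differentiableWithinAt
    · intro z hz
      rw [interior_Ici] at hz
      have hz1 : 1 < z := hz
      have hz0 : 0 < z := by linarith
      rw [(hd z).deriv]
      have h1 := pow_tangent (p - 1) (by linarith) (by linarith) (1 + z) (1 + z)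
        (by linarith) (by linarith) le_rfl
      have h3 : (2 * z) ^ (p - 1 - 1) ≤ (1 + z) ^ (p - 1 - 1) :=
        Real.rpow_le_rpow_of_nonpos (by linarith) (by linarith) (by linarith)
      rw [Real.mul_rpow (by norm_num) hz0.le] at h3
      have e3 : z ^ (p - 1 - 1) * z = z ^ (p - 1) := by
        rw [Real.rpow_sub_one hz0.ne' (p - 1)]; field_simp
      have h4 : 1 / 2 ≤ (2:ℝ) ^ (p - 1 - 1) := by
        have := Real.rpow_le_rpow_of_exponent_le (x := 2) (by norm_num)
          (show -1 ≤ p - 1 - 1 by linarith)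
        rw [Real.rpow_neg_one] at this
        linarith
      have hzq : 0 ≤ z ^ (p - 1) := by positivity
      have h5 : 1 / 2 * z ^ (p - 1) ≤ (1 + z) ^ (p - 1 - 1) * z := by
        have a1 := mul_le_mul_of_nonneg_right h3 hz0.le
        rw [mul_assoc, e3] at a1
        have a2 := mul_le_mul_of_nonneg_right h4 hzq
        linarith
      have h6 := mul_le_mul_of_nonneg_left h5 (show 0 ≤ p - 1 by linarith)
      have h7 := mul_le_mul_of_nonneg_right hc hzq
      rw [add_sub_cancel_left] at h1
      have h8 : 0 ≤ (1 + z) ^ (p - 1) - 1 - c * z ^ (p - 1) := by linarith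
      have h9 := mul_nonneg (show 0 ≤ p by linarith) h8
      linarith
  rw [← hf1]
  exact this (Set.mem_Ici.2 le_rfl) (Set.mem_Ici.2 hs) hs

lemma lower (p : ℝ) (hp1 : 1 < p) (hp2 : p < 2) (s : ℝ) :
    1 + p * s + (p - 1) / (p * 2 ^ p) * Gam p s ≤ |1 + s| ^ p := by
  obtain ⟨h2, h2'⟩ := two_rpow_bounds p hp1 hp2
  have hc0 : 0 < (p - 1) / (p * 2 ^ p) := by
    have : 0 < p - 1 := by linarith
    positivity
  -- c ≤ (p-1)/2^p
  have hc1 : (p - 1) / (p * 2 ^ p) * p = (p - 1) / 2 ^ p := by field_simp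
  have hc2 : (p - 1) / 2 ^ p ≤ (p - 1) / 2 :=
    div_le_div_of_nonneg_left (by linarith) (by norm_num) h2
  set c := (p - 1) / (p * 2 ^ p) with hc
  have e2 : (2:ℝ) ^ (p - 2) = 2 ^ p / 4 := by
    rw [Real.rpow_sub (by norm_num)]; norm_num
  unfold Gam
  split_ifs with h
  · rw [abs_le] at h
    rw [abs_of_nonneg (by linarith)]
    have hs := strong p hp1 hp2 2 (1 + s) (by norm_num) (by linarith) (by linarith)
    rw [add_sub_cancel_left, e2] at hs
    have hk : c * (p / 2) ≤ p * (p - 1) / 2 * (2 ^ p / 4) := by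
      have : c * p ≤ (p - 1) / 2 := by linarith
      have : (p - 1) * 2 ≤ p * (p - 1) * 2 ^ p := by
        have : 1 * (p-1) ≤ p * (p - 1) := mul_le_mul_of_nonneg_right hp1.le (by linarith)
        nlinarith
      linarith
    have := mul_le_mul_of_nonneg_right hk (sq_nonneg s)
    linarith
  · rcases le_or_gt 0 s with hs | hs
    · rw [abs_of_nonneg hs] at h ⊢
      push Not at h
      rw [abs_of_nonneg (by linarith)]
      have hcp : c ≤ (p - 1) / 2 := by nlinarith
      have h1 := large p hp1 hp2 c hc0.le hcp s h.le
      have hst := strong p hp1 hp2 2 2 (by norm_num) (by norm_num) le_rfl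
      rw [e2] at hst
      have hk : c * (p / 2) ≤ p * (p - 1) / 2 * (2 ^ p / 4) := by
        have : c * p ≤ (p - 1) / 2 := by linarith
        have : (p - 1) * 2 ≤ p * (p - 1) * 2 ^ p := by
          have : 1 * (p-1) ≤ p * (p - 1) := mul_le_mul_of_nonneg_right hp1.le (by linarith)
          nlinarith
        linarith
      linarith
    · rw [abs_of_neg hs] at h ⊢
      push Not at h
      obtain ⟨u, rfl⟩ : ∃ u, s = -u := ⟨-s, by ring⟩
      rw [neg_neg] at h ⊢
      have hab : |1 + -u| = u - 1 := by rw [abs_of_neg (by linarith)]; ring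
      rw [hab]
      have h0 : 0 ≤ u - 1 := by linarith
      have hcv : (u - 1 + 1) ^ p ≤ 2 ^ (p - 1) * ((u - 1) ^ p + 1 ^ p) := by
        exact_mod_cast NNReal.rpow_add_le_mul_rpow_add_rpow ⟨u - 1, h0⟩ 1 hp1.le
      rw [sub_add_cancel, Real.one_rpow, Real.rpow_sub_one (by norm_num)] at hcv
      have hX : 0 ≤ (u - 1) ^ p := Real.rpow_nonneg h0 p
      have hcc : c * 2 ^ p ≤ p - 1 := by
        have : c * 2 ^ p = (p - 1) / p := by rw [hc]; field_simp
        rw [this]; exact div_le_self (by linarith) hp1.le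
      have h6 := mul_le_mul_of_nonneg_left hcv hc0.le
      have h7 : c * (2 ^ p / 2 * ((u - 1) ^ p + 1)) ≤ (p - 1) * ((u - 1) ^ p + 1) := by
        have := mul_le_mul_of_nonneg_right hcc (show 0 ≤ (u - 1) ^ p + 1 by linarith)
        have : 0 ≤ c * 2 ^ p * ((u - 1) ^ p + 1) := by positivity
        linarith
      have : 0 ≤ c * (1 - p / 2) := mul_nonneg hc0.le (by linarith)
      nlinarith

lemma gam_scale (p : ℝ) (hp1 : 1 < p) (hp2 : p < 2) (l : ℝ) (hl : 1 ≤ l) (s : ℝ) :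
    l ^ p * Gam p s ≤ Gam p (l * s) := by
  have hl0 : 0 < l := by linarith
  have hlp : 1 ≤ l ^ p := Real.one_le_rpow hl (by linarith)
  have hle : l ^ p ≤ l ^ 2 := by
    rw [← Real.rpow_natCast]
    exact Real.rpow_le_rpow_of_exponent_le hl (by norm_num; linarith)
  unfold Gam
  rw [abs_mul, abs_of_pos hl0]
  have hs0 := abs_nonneg s
  rw [← sq_abs s, ← sq_abs (l * s), abs_mul, abs_of_pos hl0]
  generalize |s| = u at *
  split_ifs with h1 h2 h2
  · have := mul_le_mul_of_nonneg_right hle (show 0 ≤ p / 2 * u ^ 2 by positivity)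
    linarith
  · push Not at h2
    rw [Real.mul_rpow hl0.le hs0]
    have hu2 : u ^ 2 ≤ u ^ p := by
      rcases hs0.eq_or_lt with h | h
      · subst h; simp at h2; linarith
      · rw [← Real.rpow_natCast]
        exact Real.rpow_le_rpow_of_exponent_ge h h1 (by norm_num; linarith)
    have h3 : 1 ≤ l ^ p * u ^ p := by
      rw [← Real.mul_rpow hl0.le hs0]
      exact Real.one_le_rpow h2.le (by linarith)
    have h4 := mul_le_mul_of_nonneg_left hu2 (show 0 ≤ l ^ p * (p / 2) by positivity)
    nlinarith
  · nlinarith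
  · rw [Real.mul_rpow hl0.le hs0]
    nlinarith

lemma gam_neg (p s : ℝ) : Gam p (-s) = Gam p s := by simp [Gam]

lemma gamma_hom (p : ℝ) (y d : ℝ) (hy : y ≠ 0) :
    (if |d| ≤ |y| then p / 2 * |y| ^ (p - 2) * d ^ 2
        else |d| ^ p - (1 - p / 2) * |y| ^ p) = |y| ^ p * Gam p (d / y) := by
  have hy0 : 0 < |y| := abs_pos.2 hy
  unfold Gam
  simp only [abs_div, div_le_one hy0]
  have e3 : |y| ^ (p - 2) * |y| ^ 2 = |y| ^ p := by
    rw [← Real.rpow_natCast, ← Real.rpow_add hy0]; norm_num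
  split_ifs
  · rw [← e3, sq_abs]; field_simp
  · rw [Real.div_rpow (abs_nonneg _) hy0.le]
    have : 0 < |y| ^ p := by positivity
    field_simp

lemma scalar (p : ℝ) (hp1 : 1 < p) (hp2 : p < 2)
    (lam : ℝ) (hlam : 0 < lam) (hlam2 : lam ^ (p - 1) = p * (4 : ℝ) ^ p / (p - 1))
    (y d : ℝ) (G : ℝ) (hG : G = if |d| ≤ |y| then p / 2 * |y| ^ (p - 2) * d ^ 2
        else |d| ^ p - (1 - p / 2) * |y| ^ p) :
    p * (|y| ^ (p - 2) * y) * d - 2 ^ p * G ≤ |y| ^ p - |y - d| ^ p ∧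
    |y| ^ p - |y - lam * d| ^ p ≤ lam * (p * (|y| ^ (p - 2) * y) * d - 2 ^ p * G) := by
  obtain ⟨h2, h2'⟩ := two_rpow_bounds p hp1 hp2
  have h4 : (4:ℝ) ^ p = 2 ^ p * 2 ^ p := by
    rw [← Real.mul_rpow (by norm_num) (by norm_num)]; norm_num
  have hp0 : p ≠ 0 := by linarith
  have hpm : 0 < p - 1 := by linarith
  have hbig : 2 ^ p ≤ lam ^ (p - 1) := by
    rw [hlam2, h4, le_div_iff₀ hpm]
    nlinarith
  have hl1 : 1 ≤ lam := by
    by_contra hcon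
    push Not at hcon
    have := Real.rpow_lt_one hlam.le hcon hpm
    linarith
  have elam : lam ^ p = lam * lam ^ (p - 1) := by
    rw [← Real.rpow_one_add' hlam.le (by linarith)]; congr 1; ring
  by_cases hy : y = 0
  · subst hy
    have hG' : G = |d| ^ p := by
      rw [hG]
      split_ifs with h
      · have : d = 0 := by simpa using h
        subst this; simp [Real.zero_rpow hp0]
      · simp [Real.zero_rpow hp0]
    have hd : 0 ≤ |d| ^ p := by positivity
    rw [hG']
    simp only [abs_zero, Real.zero_rpow hp0, mul_zero, zero_mul, zero_sub, abs_neg, abs_mul,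
      abs_of_pos hlam, Real.mul_rpow hlam.le (abs_nonneg d)]
    constructor
    · nlinarith
    · rw [elam]
      have := mul_le_mul_of_nonneg_right hbig (mul_nonneg hlam.le hd)
      linarith
  · rw [gamma_hom p y d hy] at hG
    have hy0 : 0 < |y| := abs_pos.2 hy
    have e3 : |y| ^ (p - 2) * |y| ^ 2 = |y| ^ p := by
      rw [← Real.rpow_natCast, ← Real.rpow_add hy0]; norm_num
    rw [sq_abs] at e3
    obtain ⟨s, rfl⟩ : ∃ s, d = y * s := ⟨d / y, by field_simp⟩
    rw [mul_div_cancel_left₀ s hy] at hG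
    have hY : 0 < |y| ^ p := by positivity
    have e1 : p * (|y| ^ (p - 2) * y) * (y * s) = |y| ^ p * (p * s) := by
      rw [← e3]; ring
    have ea : |y - y * s| ^ p = |y| ^ p * |1 + -s| ^ p := by
      rw [← Real.mul_rpow (abs_nonneg _) (abs_nonneg _), ← abs_mul]; congr 2; ring
    have eb : |y - lam * (y * s)| ^ p = |y| ^ p * |1 + -(lam * s)| ^ p := by
      rw [← Real.mul_rpow (abs_nonneg _) (abs_nonneg _), ← abs_mul]; congr 2; ring
    rw [e1, ea, eb, hG]
    constructor
    · have h := mul_le_mul_of_nonneg_left (upper p hp1 hp2 (-s)) hY.le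
      rw [gam_neg] at h
      linarith
    · have h := lower p hp1 hp2 (-(lam * s))
      rw [gam_neg] at h
      have hs := gam_scale p hp1 hp2 lam hl1 s
      have hc0 : 0 ≤ (p - 1) / (p * 2 ^ p) := by positivity
      have hs' := mul_le_mul_of_nonneg_left hs hc0
      have ec : (p - 1) / (p * 2 ^ p) * (lam ^ p * Gam p s) = lam * 2 ^ p * Gam p s := by
        rw [elam, hlam2, h4]; field_simp
      rw [ec] at hs'
      have h5 : 1 + p * -(lam * s) + lam * 2 ^ p * Gam p s ≤ |1 + -(lam * s)| ^ p := by linarith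
      have := mul_le_mul_of_nonneg_left h5 hY.le
      linarith

theorem stmt_11 (p : ℝ) (hp1 : 1 < p) (hp2 : p < 2)
    (lam : ℝ) (hlam : 0 < lam) (hlam2 : lam ^ (p - 1) = p * (4 : ℝ) ^ p / (p - 1))
    (m n : ℕ) (N : Matrix (Fin m) (Fin n) ℝ) (x : Fin n → ℝ)
    (γ : ℝ → ℝ → ℝ)
    (hγ : ∀ t z, γ t z = if |z| ≤ t then p / 2 * t ^ (p - 2) * z ^ 2
        else |z| ^ p - (1 - p / 2) * t ^ p)
    (g : Fin n → ℝ)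
    (hg : g = fun j =>
        p * ((Nᵀ).mulVec (fun i => |N.mulVec x i| ^ (p - 2) * N.mulVec x i)) j)
    (res : (Fin n → ℝ) → ℝ)
    (hres : ∀ Δ, res Δ = g ⬝ᵥ Δ - (2 : ℝ) ^ p * ∑ i, γ |N.mulVec x i| (N.mulVec Δ i)) :
    ∀ Δ : Fin n → ℝ,
      res Δ ≤ (∑ i, |N.mulVec x i| ^ p) - (∑ i, |N.mulVec (x - Δ) i| ^ p) ∧
      (∑ i, |N.mulVec x i| ^ p) - (∑ i, |N.mulVec (x - lam • Δ) i| ^ p) ≤ lam * res Δ := by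
  intro Δ
  have key : res Δ = ∑ i, (p * (|N.mulVec x i| ^ (p - 2) * N.mulVec x i) * N.mulVec Δ i
      - 2 ^ p * γ |N.mulVec x i| (N.mulVec Δ i)) := by
    rw [hres, Finset.sum_sub_distrib, Finset.mul_sum]
    congr 1
    have : g = p • (Nᵀ).mulVec (fun i => |N.mulVec x i| ^ (p - 2) * N.mulVec x i) := by
      rw [hg]; rfl
    rw [this, smul_dotProduct, Matrix.mulVec_transpose, ← Matrix.dotProduct_mulVec]
    simp only [dotProduct, smul_eq_mul, Finset.mul_sum]
    exact Finset.sum_congr rfl fun i _ => by ring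
  have hs := fun i => scalar p hp1 hp2 lam hlam hlam2 (N.mulVec x i) (N.mulVec Δ i) _
    (hγ |N.mulVec x i| (N.mulVec Δ i))
  rw [key, Finset.mul_sum, ← Finset.sum_sub_distrib, ← Finset.sum_sub_distrib]
  constructor
  · apply Finset.sum_le_sum
    intro i _
    rw [Matrix.mulVec_sub]
    exact (hs i).1
  · apply Finset.sum_le_sum
    intro i _
    rw [Matrix.mulVec_sub, Matrix.mulVec_smul]
    exact (hs i).2
end

section
/- Let p, q ≥ 2 be real numbers, g ∈ ℝ^n, R ∈ ℝ^(n×n) symmetric positive semidefinite, N ∈ ℝ^(m×n), A ∈ ℝ^(d×n), ζ > 0, and res_p(Δ) = gᵀΔ − ΔᵀRΔ − ‖NΔ‖_p^p. Suppose Δ* satisfies AΔ* = 0, res_p(Δ*) ≥ res_p(Δ) for all Δ with AΔ = 0, and ζ/2 < res_p(Δ*) ≤ ζ. Then there exists Δ with AΔ = 0 such that gᵀΔ − ΔᵀRΔ − (1/4)·ζ^(1 − q/p)·m^(min(q/p − 1, 0))·‖NΔ‖_q^q ≥ ζ/4; in fact Δ = Δ* has this property. -/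
open Matrix

lemma aux_sum (m : ℕ) (y : Fin m → ℝ) (hy : ∀ i, 0 ≤ y i) (ζ s : ℝ) (hζ : 0 < ζ) (hs : 0 < s)
    (hsum : ∑ i, y i ≤ ζ) :
    ζ ^ (1 - s) * (m : ℝ) ^ (min (s - 1) 0) * ∑ i, y i ^ s ≤ ζ := by
  rcases le_total 1 s with h1 | h1
  · rw [min_eq_right (by linarith), Real.rpow_zero, mul_one, Finset.mul_sum]
    refine le_trans (Finset.sum_le_sum fun i _ => ?_) hsum
    have hyi : y i ≤ ζ :=
      (Finset.single_le_sum (fun j _ => hy j) (Finset.mem_univ i)).trans hsum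
    have e : y i ^ s = y i ^ (s - 1) * y i := by
      rcases (hy i).eq_or_lt with h | h
      · rw [← h, Real.zero_rpow hs.ne', mul_zero]
      · rw [← Real.rpow_add_one h.ne', sub_add_cancel]
    have h2 : y i ^ (s - 1) ≤ ζ ^ (s - 1) := Real.rpow_le_rpow (hy i) hyi (by linarith)
    have h3 : ζ ^ (1 - s) * ζ ^ (s - 1) = 1 := by
      rw [← Real.rpow_add hζ]; simp
    calc ζ ^ (1 - s) * y i ^ s = ζ ^ (1 - s) * y i ^ (s - 1) * y i := by rw [e, mul_assoc]
      _ ≤ ζ ^ (1 - s) * ζ ^ (s - 1) * y i := by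
        have := hy i
        gcongr
      _ = y i := by rw [h3, one_mul]
  · rw [min_eq_left (by linarith)]
    rcases Nat.eq_zero_or_pos m with h0 | h0
    · subst h0
      simpa using hζ.le
    have hm : (0 : ℝ) < m := by exact_mod_cast h0
    have e : ζ ^ (1 - s) * (m : ℝ) ^ (s - 1) = (ζ / m) ^ (1 - s) := by
      rw [Real.div_rpow hζ.le hm.le, div_eq_mul_inv, ← Real.rpow_neg hm.le, neg_sub]
    rw [e, Finset.mul_sum]
    calc ∑ i, (ζ / m) ^ (1 - s) * y i ^ s ≤ ∑ i, ((1 - s) * (ζ / m) + s * y i) :=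
          Finset.sum_le_sum fun i _ =>
            Real.geom_mean_le_arith_mean2_weighted (by linarith) hs.le (by positivity) (hy i)
              (by ring)
      _ = (1 - s) * ζ + s * ∑ i, y i := by
          rw [Finset.sum_add_distrib, Finset.mul_sum]
          simp
          field_simp
      _ ≤ (1 - s) * ζ + s * ζ := by gcongr
      _ = ζ := by ring

lemma aux_opt (p a r P : ℝ)
    (h : ∀ t : ℝ, 0 < t → t * a - t ^ 2 * r - t ^ p * P ≤ a - r - P) :
    a - 2 * r - p * P = 0 := by
  have hd : HasDerivAt (fun t : ℝ => t * a - t ^ 2 * r - t ^ p * P)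
      (a - 2 * r - p * P) 1 := by
    have h1 := (hasDerivAt_id (1 : ℝ)).mul_const a
    have h2 := (hasDerivAt_pow 2 (1 : ℝ)).mul_const r
    have h3 := (Real.hasDerivAt_rpow_const (x := 1) (p := p) (Or.inl one_ne_zero)).mul_const P
    have := (h1.sub h2).sub h3
    refine HasDerivAt.congr_deriv (this : HasDerivAt (fun t : ℝ => t * a - t ^ 2 * r - t ^ p * P) _ 1) ?_
    simp
  refine IsLocalMax.hasDerivAt_eq_zero (f := fun t : ℝ => t * a - t ^ 2 * r - t ^ p * P) ?_ hd
  filter_upwards [lt_mem_nhds (zero_lt_one' ℝ)] with t ht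
  simpa using h t ht

theorem stmt_12 (p q : ℝ) (hp : 2 ≤ p) (hq : 2 ≤ q) (n m d : ℕ)
    (g : Fin n → ℝ) (R : Matrix (Fin n) (Fin n) ℝ) (hR : R.PosSemidef)
    (N : Matrix (Fin m) (Fin n) ℝ) (A : Matrix (Fin d) (Fin n) ℝ)
    (ζ : ℝ) (hζ : 0 < ζ)
    (res : (Fin n → ℝ) → ℝ)
    (hres : ∀ Δ, res Δ = g ⬝ᵥ Δ - Δ ⬝ᵥ R.mulVec Δ - ∑ i, |N.mulVec Δ i| ^ p)
    (Δs : Fin n → ℝ) (hfeas : A.mulVec Δs = 0)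
    (hopt : ∀ Δ, A.mulVec Δ = 0 → res Δ ≤ res Δs)
    (hlow : ζ / 2 < res Δs) (hhigh : res Δs ≤ ζ) :
    (∃ Δ : Fin n → ℝ, A.mulVec Δ = 0 ∧
      ζ / 4 ≤ g ⬝ᵥ Δ - Δ ⬝ᵥ R.mulVec Δ
        - (1 / 4) * ζ ^ (1 - q / p) * (m : ℝ) ^ (min (q / p - 1) 0)
          * ∑ i, |N.mulVec Δ i| ^ q) ∧
    ζ / 4 ≤ g ⬝ᵥ Δs - Δs ⬝ᵥ R.mulVec Δs
        - (1 / 4) * ζ ^ (1 - q / p) * (m : ℝ) ^ (min (q / p - 1) 0)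
          * ∑ i, |N.mulVec Δs i| ^ q := by
  have hr : 0 ≤ Δs ⬝ᵥ R.mulVec Δs := by simpa using hR.dotProduct_mulVec_nonneg Δs
  have hP : 0 ≤ ∑ i, |N.mulVec Δs i| ^ p := by positivity
  have key := aux_opt p (g ⬝ᵥ Δs) (Δs ⬝ᵥ R.mulVec Δs) (∑ i, |N.mulVec Δs i| ^ p) (by
    intro t ht
    have h := hopt (t • Δs) (by rw [Matrix.mulVec_smul, hfeas, smul_zero])
    rw [hres, hres] at h
    have e : ∑ i, |N.mulVec (t • Δs) i| ^ p = t ^ p * ∑ i, |N.mulVec Δs i| ^ p := by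
      rw [Finset.mul_sum]
      refine Finset.sum_congr rfl fun i _ => ?_
      rw [Matrix.mulVec_smul, Pi.smul_apply, smul_eq_mul, abs_mul, abs_of_pos ht,
        Real.mul_rpow ht.le (abs_nonneg _)]
    rw [e] at h
    simp only [Matrix.mulVec_smul, dotProduct_smul, smul_dotProduct, smul_eq_mul] at h
    linarith)
  rw [hres] at hlow hhigh
  have hPζ : ∑ i, |N.mulVec Δs i| ^ p ≤ ζ := by nlinarith
  have hs := aux_sum m (fun i => |N.mulVec Δs i| ^ p) (fun i => by positivity) ζ (q / p) hζ
    (by positivity) hPζ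
  have e : ∀ i, (|N.mulVec Δs i| ^ p) ^ (q / p) = |N.mulVec Δs i| ^ q := fun i => by
    rw [← Real.rpow_mul (abs_nonneg _), mul_div_cancel₀ _ (by positivity)]
  simp only [e] at hs
  have fin : ζ / 4 ≤ g ⬝ᵥ Δs - Δs ⬝ᵥ R.mulVec Δs
        - (1 / 4) * ζ ^ (1 - q / p) * (m : ℝ) ^ (min (q / p - 1) 0)
          * ∑ i, |N.mulVec Δs i| ^ q := by
    linarith
  exact ⟨⟨Δs, hfeas, fin⟩, fin⟩
end

section
/- Let p, q ≥ 2 and β ≥ 1 be real numbers, g ∈ ℝ^n, R ∈ ℝ^(n×n) symmetric positive semidefinite, N ∈ ℝ^(m×n), A ∈ ℝ^(d×n), ζ > 0, and res_p(Δ) = gᵀΔ − ΔᵀRΔ − ‖NΔ‖_p^p. Assume res_p(Δ) ≤ ζ for every Δ with AΔ = 0. Suppose Δ̃ satisfies AΔ̃ = 0, gᵀΔ̃ ≤ ζ, and gᵀΔ̃ − Δ̃ᵀRΔ̃ − (1/4)·ζ^(1 − q/p)·m^(min(q/p − 1, 0))·‖NΔ̃‖_q^q ≥ ζ/(16β). Then,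 with α = (1/(256β))·m^(−(p/(p−1))·|1/p − 1/q|), one has res_p(α·Δ̃) ≥ α·ζ/(64β); in particular res_p(α·Δ̃) ≥ (1/(64β))·α·res_p(Δ) for every Δ with AΔ = 0. -/
open Matrix

theorem aux_sum_le {m : ℕ} (a : Fin m → ℝ) (ha : ∀ i, 0 ≤ a i) (r : ℝ) (hr : 1 ≤ r) :
    ∑ i, a i ^ r ≤ (∑ i, a i) ^ r := by
  have hS : 0 ≤ ∑ i, a i := Finset.sum_nonneg fun i _ => ha i
  have key : ∀ x : ℝ, 0 ≤ x → x ^ r = x * x ^ (r - 1) := by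
    intro x hx
    have := Real.rpow_add_of_nonneg hx (zero_le_one) (sub_nonneg.2 hr)
    rw [Real.rpow_one] at this
    rw [← this]; congr 1; ring
  rw [key _ hS, Finset.sum_mul]
  refine Finset.sum_le_sum fun i _ => ?_
  rw [key _ (ha i)]
  refine mul_le_mul_of_nonneg_left ?_ (ha i)
  exact Real.rpow_le_rpow (ha i) (Finset.single_le_sum (fun j _ => ha j) (Finset.mem_univ i))
    (sub_nonneg.2 hr)

theorem aux_norm (p q ζ : ℝ) (hp : 2 ≤ p) (hq : 2 ≤ q) (hζ : 0 < ζ) (m : ℕ) (hm : 0 < m)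
    (x : Fin m → ℝ)
    (h : (1 / 4) * ζ ^ (1 - q / p) * (m : ℝ) ^ (min (q / p - 1) 0) * ∑ i, |x i| ^ q ≤ ζ) :
    ∑ i, |x i| ^ p ≤ 4 ^ (p / q) * ζ * (m : ℝ) ^ (p * |1 / p - 1 / q|) := by
  have hm' : (0 : ℝ) < m := by exact_mod_cast hm
  have hp0 : 0 < p := by linarith
  have hq0 : 0 < q := by linarith
  set S := ∑ i, |x i| ^ q with hS
  have hS0 : 0 ≤ S := Finset.sum_nonneg fun i _ => by positivity
  have hSle : S ≤ 4 * ζ ^ (q / p) * (m : ℝ) ^ (-(min (q / p - 1) 0)) := by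
    rw [Real.rpow_neg hm'.le, ← div_eq_mul_inv, le_div_iff₀ (by positivity)]
    rw [Real.rpow_sub hζ, Real.rpow_one] at h
    have hz : 0 < ζ ^ (q / p) := by positivity
    have h2 : (1 / 4) * (ζ / ζ ^ (q / p)) * (m : ℝ) ^ (min (q / p - 1) 0) * S
       = (S * (m : ℝ) ^ (min (q / p - 1) 0)) * ζ / (4 * ζ ^ (q / p)) := by
      field_simp
    rw [h2, div_le_iff₀ (by positivity)] at h
    nlinarith
  have hpw : S ^ (p / q) ≤ 4 ^ (p / q) * ζ * (m : ℝ) ^ (-(min (q / p - 1) 0) * (p / q)) := by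
    refine (Real.rpow_le_rpow hS0 hSle (by positivity)).trans (le_of_eq ?_)
    rw [Real.mul_rpow (by positivity) (by positivity), Real.mul_rpow (by positivity) (by positivity),
      ← Real.rpow_mul hζ.le, ← Real.rpow_mul hm'.le]
    have : q / p * (p / q) = 1 := by field_simp
    rw [this, Real.rpow_one]
  rcases le_total q p with hqp | hqp
  · have h1 : ∑ i, |x i| ^ p ≤ S ^ (p / q) := by
      have := aux_sum_le (fun i => |x i| ^ q) (fun i => by positivity) (p / q)
        ((one_le_div hq0).2 hqp)
      refine le_trans (le_of_eq (Finset.sum_congr rfl fun i _ => ?_)) this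
      rw [← Real.rpow_mul (abs_nonneg _)]; congr 1; field_simp
    refine h1.trans (hpw.trans (le_of_eq ?_))
    have e1 : min (q / p - 1) 0 = q / p - 1 :=
      min_eq_left (by have := (div_le_one hp0).2 hqp; linarith)
    have e2 : |1 / p - 1 / q| = 1 / q - 1 / p := by
      rw [abs_of_nonpos (by have := one_div_le_one_div_of_le hq0 hqp; linarith)]; ring
    rw [e1, e2]; congr 2; field_simp; ring
  · have h1 := Real.rpow_sum_le_const_mul_sum_rpow (Finset.univ : Finset (Fin m))
      (fun i => |x i| ^ p) (p := q / p) ((one_le_div hp0).2 hqp)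
    have h2 : ∑ i, |(|x i| ^ p)| ^ (q / p) = S := by
      refine Finset.sum_congr rfl fun i _ => ?_
      rw [abs_of_nonneg (by positivity), ← Real.rpow_mul (abs_nonneg _)]; congr 1; field_simp
    have h3 : ∑ i, |(|x i| ^ p)| = ∑ i, |x i| ^ p :=
      Finset.sum_congr rfl fun i _ => abs_of_nonneg (by positivity)
    rw [h2, h3, Finset.card_univ, Fintype.card_fin] at h1
    have hP0 : 0 ≤ ∑ i, |x i| ^ p := Finset.sum_nonneg fun i _ => by positivity
    have h4 := Real.rpow_le_rpow (by positivity) h1 (z := p / q) (by positivity)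
    rw [← Real.rpow_mul hP0, Real.mul_rpow (by positivity) hS0, ← Real.rpow_mul hm'.le,
      show q / p * (p / q) = 1 by field_simp, Real.rpow_one] at h4
    refine h4.trans ?_
    have e1 : min (q / p - 1) 0 = 0 :=
      min_eq_right (by have := (one_le_div hp0).2 hqp; linarith)
    have e2 : |1 / p - 1 / q| = 1 / p - 1 / q :=
      abs_of_nonneg (by have := one_div_le_one_div_of_le hp0 hqp; linarith)
    rw [e1, neg_zero, zero_mul, Real.rpow_zero, mul_one] at hpw
    rw [e2, mul_comm]
    have e3 : (q / p - 1) * (p / q) = p * (1 / p - 1 / q) := by field_simp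
    rw [e3]
    exact mul_le_mul_of_nonneg_right hpw (by positivity)

theorem aux_alpha (p q β ζ : ℝ) (hp : 2 ≤ p) (hq : 2 ≤ q) (hβ : 1 ≤ β) (hζ : 0 < ζ) (m : ℕ)
    (x : Fin m → ℝ)
    (h : (1 / 4) * ζ ^ (1 - q / p) * (m : ℝ) ^ (min (q / p - 1) 0) * ∑ i, |x i| ^ q ≤ ζ)
    (α : ℝ) (hα : α = (1 / (256 * β)) * (m : ℝ) ^ (-(p / (p - 1)) * |1 / p - 1 / q|)) :
    α ^ p * ∑ i, |x i| ^ p ≤ α * (ζ / (64 * β)) := by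
  have hβ0 : 0 < β := by linarith
  rcases Nat.eq_zero_or_pos m with rfl | hm
  · have h0 : 0 ≤ α := by rw [hα]; positivity
    simp only [Finset.univ_eq_empty, Finset.sum_empty, mul_zero]
    positivity
  have hm' : (0 : ℝ) < m := by exact_mod_cast hm
  have hα0 : 0 < α := by rw [hα]; positivity
  have hn := aux_norm p q ζ hp hq hζ m hm x h
  have hap : α ^ p = α * α ^ (p - 1) := by
    rw [Real.rpow_sub hα0, Real.rpow_one]; field_simp
  rw [hap, mul_assoc]
  refine mul_le_mul_of_nonneg_left ?_ hα0.le
  refine (mul_le_mul_of_nonneg_left hn (by positivity)).trans ?_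
  have ha1 : α ^ (p - 1) = (1 / (256 * β)) ^ (p - 1) * (m : ℝ) ^ (-(p * |1 / p - 1 / q|)) := by
    rw [hα, Real.mul_rpow (by positivity) (by positivity), ← Real.rpow_mul hm'.le]
    congr 2
    have : p - 1 ≠ 0 := by linarith
    field_simp
  have hM : 0 < (m : ℝ) ^ (p * |1 / p - 1 / q|) := by positivity
  rw [ha1, Real.rpow_neg hm'.le]
  have hb : (1 / (256 * β)) ^ (p - 1) ≤ 1 / (256 * β) * (1 / 256) ^ (p - 2) := by
    have h1 : (1 / (256 * β)) ^ (p - 1) = 1 / (256 * β) * (1 / (256 * β)) ^ (p - 2) := by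
      have : p - 1 = 1 + (p - 2) := by ring
      rw [this, Real.rpow_add (by positivity), Real.rpow_one]
    rw [h1]
    refine mul_le_mul_of_nonneg_left ?_ (by positivity)
    refine Real.rpow_le_rpow (by positivity) ?_ (by linarith)
    exact one_div_le_one_div_of_le (by norm_num) (by linarith)
  have h4 : (4 : ℝ) ^ (p / q) ≤ 4 * 4 ^ (p - 2) := by
    have : (4 : ℝ) * 4 ^ (p - 2) = 4 ^ (p - 1) := by
      have : p - 1 = 1 + (p - 2) := by ring
      rw [this, Real.rpow_add (by positivity), Real.rpow_one]
    rw [this]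
    refine Real.rpow_le_rpow_of_exponent_le (by norm_num) ?_
    rw [div_le_iff₀ (by linarith)]
    nlinarith
  have h5 : (1 / 256 : ℝ) ^ (p - 2) * 4 ^ (p - 2) ≤ 1 := by
    rw [← Real.mul_rpow (by norm_num) (by norm_num)]
    exact Real.rpow_le_one (by norm_num) (by norm_num) (by linarith)
  calc _ = ((1 / (256 * β)) ^ (p - 1) * 4 ^ (p / q)) * ζ := by field_simp
    _ ≤ ((1 / (256 * β) * (1 / 256) ^ (p - 2)) * (4 * 4 ^ (p - 2))) * ζ := by
      refine mul_le_mul_of_nonneg_right ?_ hζ.le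
      exact mul_le_mul hb h4 (by positivity) (by positivity)
    _ = (ζ / (64 * β)) * ((1 / 256 : ℝ) ^ (p - 2) * 4 ^ (p - 2)) := by ring
    _ ≤ (ζ / (64 * β)) * 1 := mul_le_mul_of_nonneg_left h5 (by positivity)
    _ = _ := mul_one _

theorem stmt_13 (p q β : ℝ) (hp : 2 ≤ p) (hq : 2 ≤ q) (hβ : 1 ≤ β) (n m d : ℕ)
    (g : Fin n → ℝ) (R : Matrix (Fin n) (Fin n) ℝ) (hR : R.PosSemidef)
    (N : Matrix (Fin m) (Fin n) ℝ) (A : Matrix (Fin d) (Fin n) ℝ)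
    (ζ : ℝ) (hζ : 0 < ζ)
    (res : (Fin n → ℝ) → ℝ)
    (hres : ∀ Δ, res Δ = g ⬝ᵥ Δ - Δ ⬝ᵥ R.mulVec Δ - ∑ i, |N.mulVec Δ i| ^ p)
    (hub : ∀ Δ, A.mulVec Δ = 0 → res Δ ≤ ζ)
    (Δt : Fin n → ℝ) (hfeas : A.mulVec Δt = 0) (hlin : g ⬝ᵥ Δt ≤ ζ)
    (hval : ζ / (16 * β) ≤ g ⬝ᵥ Δt - Δt ⬝ᵥ R.mulVec Δt
        - (1 / 4) * ζ ^ (1 - q / p) * (m : ℝ) ^ (min (q / p - 1) 0)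
          * ∑ i, |N.mulVec Δt i| ^ q)
    (α : ℝ) (hα : α = (1 / (256 * β)) * (m : ℝ) ^ (-(p / (p - 1)) * |1 / p - 1 / q|)) :
    α * ζ / (64 * β) ≤ res (α • Δt) ∧
    ∀ Δ : Fin n → ℝ, A.mulVec Δ = 0 → (1 / (64 * β)) * α * res Δ ≤ res (α • Δt) := by
  have hβ0 : 0 < β := by linarith
  have hα0 : 0 ≤ α := by rw [hα]; positivity
  have hQ : 0 ≤ Δt ⬝ᵥ R.mulVec Δt := by simpa using hR.dotProduct_mulVec_nonneg Δt
  have hc : 0 ≤ (1 / 4) * ζ ^ (1 - q / p) * (m : ℝ) ^ (min (q / p - 1) 0)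
          * ∑ i, |N.mulVec Δt i| ^ q :=
    mul_nonneg (by positivity) (Finset.sum_nonneg fun i _ => by positivity)
  have hz : 0 < ζ / (16 * β) := by positivity
  have hS := aux_alpha p q β ζ hp hq hβ hζ m (N.mulVec Δt) (by linarith) α hα
  have hα1 : α ≤ 1 / (256 * β) := by
    rw [hα]
    refine mul_le_of_le_one_right (by positivity) ?_
    have he : -(p / (p - 1)) * |1 / p - 1 / q| ≤ 0 := by
      have : 0 ≤ p / (p - 1) := div_nonneg (by linarith) (by linarith)
      have := mul_nonneg this (abs_nonneg (1 / p - 1 / q))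
      linarith
    rcases Nat.eq_zero_or_pos m with rfl | hm
    · rw [Nat.cast_zero]
      exact Real.zero_rpow_le_one _
    · exact Real.rpow_le_one_of_one_le_of_nonpos (by exact_mod_cast hm) he
  have hr : res (α • Δt) = α * (g ⬝ᵥ Δt) - α * (α * (Δt ⬝ᵥ R.mulVec Δt))
      - α ^ p * ∑ i, |N.mulVec Δt i| ^ p := by
    rw [hres, Finset.mul_sum]
    simp only [Matrix.mulVec_smul, dotProduct_smul, smul_dotProduct, smul_eq_mul, Pi.smul_apply,
      abs_mul, abs_of_nonneg hα0]
    congr 1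
    exact Finset.sum_congr rfl fun i _ => Real.mul_rpow hα0 (abs_nonneg _)
  have main : α * ζ / (64 * β) ≤ res (α • Δt) := by
    have hQ1 : α * (Δt ⬝ᵥ R.mulVec Δt) ≤ 1 / (256 * β) * ζ :=
      mul_le_mul hα1 (by linarith) hQ (by positivity)
    have h1 : α * (α * (Δt ⬝ᵥ R.mulVec Δt)) ≤ α * (1 / (256 * β) * ζ) :=
      mul_le_mul_of_nonneg_left hQ1 hα0
    have h2 : α * (ζ / (16 * β)) ≤ α * (g ⬝ᵥ Δt) :=
      mul_le_mul_of_nonneg_left (by linarith) hα0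
    have e : 0 ≤ α * (ζ / β) := by positivity
    have e1 : α * (1 / (256 * β) * ζ) = α * (ζ / β) / 256 := by field_simp
    have e2 : α * (ζ / (16 * β)) = α * (ζ / β) / 16 := by field_simp
    have e3 : α * (ζ / (64 * β)) = α * (ζ / β) / 64 := by field_simp
    have e4 : α * ζ / (64 * β) = α * (ζ / β) / 64 := by field_simp
    rw [hr, e4]
    linarith
  refine ⟨main, fun Δ hΔ => le_trans ?_ main⟩
  have : (1 / (64 * β)) * α * res Δ ≤ (1 / (64 * β)) * α * ζ :=
    mul_le_mul_of_nonneg_left (hub Δ hΔ) (by positivity)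
  refine this.trans (le_of_eq ?_)
  ring
end

section
/- Let A ∈ ℝ^(d×n), M ∈ ℝ^(m₂×n), N ∈ ℝ^(m×n), c ∈ ℝ^d, and let r, r' ∈ ℝ^m satisfy 0 < r_e ≤ r'_e for every e. For a weight vector s define the energy E_s(Δ) = ΔᵀMᵀMΔ + Σ_e s_e·(NΔ)_e². Suppose Δ̃ satisfies AΔ̃ = c and E_r(Δ̃) ≤ E_r(Δ) for every Δ with AΔ = c. Then for every Δ' with AΔ' = c, E_{r'}(Δ') ≥ E_r(Δ̃) + Σ_e (1 − r_e/r'_e)·r_e·(NΔ̃)_e². Equivalently, the minimum energy Ψ(r') over {Δ : AΔ = c} satisfies Ψ(r') ≥ Ψ(r) + Σ_e (1 − r_e/r'_e)·r_e·(NΔ̃)_e². -/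
open Matrix

theorem stmt_14 (d n m m₂ : ℕ)
    (A : Matrix (Fin d) (Fin n) ℝ) (M : Matrix (Fin m₂) (Fin n) ℝ)
    (N : Matrix (Fin m) (Fin n) ℝ) (c : Fin d → ℝ)
    (r r' : Fin m → ℝ) (hr : ∀ e, 0 < r e) (hrr' : ∀ e, r e ≤ r' e)
    (E : (Fin m → ℝ) → (Fin n → ℝ) → ℝ)
    (hE : ∀ s Δ, E s Δ = Δ ⬝ᵥ (Mᵀ * M).mulVec Δ + ∑ e, s e * (N.mulVec Δ e) ^ 2)
    (Δt : Fin n → ℝ) (hfeas : A.mulVec Δt = c)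
    (hopt : ∀ Δ, A.mulVec Δ = c → E r Δt ≤ E r Δ) :
    ∀ Δ' : Fin n → ℝ, A.mulVec Δ' = c →
      E r Δt + ∑ e, (1 - r e / r' e) * r e * (N.mulVec Δt e) ^ 2 ≤ E r' Δ' := by
  intro Δ' h'
  have hM : ∀ Δ : Fin n → ℝ, Δ ⬝ᵥ (Mᵀ * M).mulVec Δ = ∑ i, (M.mulVec Δ i) ^ 2 := by
    intro Δ
    rw [← Matrix.mulVec_mulVec, Matrix.dotProduct_mulVec, Matrix.vecMul_transpose]
    simp only [dotProduct, pow_two]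
  have hline : ∀ t : ℝ, E r (Δt + t • (Δ' - Δt)) = E r Δt
      + 2 * t * (∑ i, M.mulVec Δt i * (M.mulVec Δ' i - M.mulVec Δt i)
        + ∑ e, r e * (N.mulVec Δt e * (N.mulVec Δ' e - N.mulVec Δt e)))
      + t ^ 2 * (∑ i, (M.mulVec Δ' i - M.mulVec Δt i) ^ 2
        + ∑ e, r e * (N.mulVec Δ' e - N.mulVec Δt e) ^ 2) := by
    intro t
    have h1 : ∑ i, (M.mulVec (Δt + t • (Δ' - Δt)) i) ^ 2 = ∑ i, (M.mulVec Δt i) ^ 2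
        + 2 * t * ∑ i, M.mulVec Δt i * (M.mulVec Δ' i - M.mulVec Δt i)
        + t ^ 2 * ∑ i, (M.mulVec Δ' i - M.mulVec Δt i) ^ 2 := by
      rw [Finset.mul_sum, Finset.mul_sum, ← Finset.sum_add_distrib, ← Finset.sum_add_distrib]
      refine Finset.sum_congr rfl fun i _ => ?_
      simp only [Matrix.mulVec_add, Matrix.mulVec_smul, Matrix.mulVec_sub, Pi.add_apply,
        Pi.smul_apply, Pi.sub_apply, smul_eq_mul]
      ring
    have h2 : ∑ e, r e * (N.mulVec (Δt + t • (Δ' - Δt)) e) ^ 2 = ∑ e, r e * (N.mulVec Δt e) ^ 2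
        + 2 * t * ∑ e, r e * (N.mulVec Δt e * (N.mulVec Δ' e - N.mulVec Δt e))
        + t ^ 2 * ∑ e, r e * (N.mulVec Δ' e - N.mulVec Δt e) ^ 2 := by
      rw [Finset.mul_sum, Finset.mul_sum, ← Finset.sum_add_distrib, ← Finset.sum_add_distrib]
      refine Finset.sum_congr rfl fun i _ => ?_
      simp only [Matrix.mulVec_add, Matrix.mulVec_smul, Matrix.mulVec_sub, Pi.add_apply,
        Pi.smul_apply, Pi.sub_apply, smul_eq_mul]
      ring
    rw [hE, hE, hM, hM, h1, h2]
    ring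
  set B := ∑ i, M.mulVec Δt i * (M.mulVec Δ' i - M.mulVec Δt i)
        + ∑ e, r e * (N.mulVec Δt e * (N.mulVec Δ' e - N.mulVec Δt e)) with hB
  have hB0 : B = 0 := by
    have hd := discrim_le_zero (a := ∑ i, (M.mulVec Δ' i - M.mulVec Δt i) ^ 2
        + ∑ e, r e * (N.mulVec Δ' e - N.mulVec Δt e) ^ 2) (b := 2 * B) (c := 0) (by
      intro t
      have h := hopt (Δt + t • (Δ' - Δt)) (by
        simp [Matrix.mulVec_add, Matrix.mulVec_smul, Matrix.mulVec_sub, hfeas, h'])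
      rw [hline t] at h
      linarith)
    unfold discrim at hd
    nlinarith [sq_nonneg B]
  have hMle : ∑ i, (M.mulVec Δt i) ^ 2
      + 2 * ∑ i, M.mulVec Δt i * (M.mulVec Δ' i - M.mulVec Δt i) ≤ ∑ i, (M.mulVec Δ' i) ^ 2 := by
    rw [Finset.mul_sum, ← Finset.sum_add_distrib]
    refine Finset.sum_le_sum fun i _ => ?_
    nlinarith [sq_nonneg (M.mulVec Δ' i - M.mulVec Δt i)]
  have hNle : ∑ e, r e * (N.mulVec Δt e) ^ 2
      + ∑ e, (1 - r e / r' e) * r e * (N.mulVec Δt e) ^ 2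
      + 2 * ∑ e, r e * (N.mulVec Δt e * (N.mulVec Δ' e - N.mulVec Δt e))
      ≤ ∑ e, r' e * (N.mulVec Δ' e) ^ 2 := by
    rw [Finset.mul_sum, ← Finset.sum_add_distrib, ← Finset.sum_add_distrib]
    refine Finset.sum_le_sum fun e _ => ?_
    have hp : 0 < r' e := (hr e).trans_le (hrr' e)
    have hsq : 0 ≤ r' e * (N.mulVec Δ' e - r e / r' e * N.mulVec Δt e) ^ 2 := by positivity
    have heq : r' e * (N.mulVec Δ' e - r e / r' e * N.mulVec Δt e) ^ 2
        = r' e * (N.mulVec Δ' e) ^ 2 - (r e * (N.mulVec Δt e) ^ 2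
          + (1 - r e / r' e) * r e * (N.mulVec Δt e) ^ 2
          + 2 * (r e * (N.mulVec Δt e * (N.mulVec Δ' e - N.mulVec Δt e)))) := by
      field_simp
      ring
    linarith
  rw [hE, hE, hM, hM]
  linarith
end

section
/- Let p ≥ 2 be a real number, ζ > 0, A ∈ ℝ^(d×n), M ∈ ℝ^(m₂×n), N ∈ ℝ^(m₁×n), c ∈ ℝ^d, and let w ∈ ℝ^(m₁) with w_e ≥ 1 for all e; set r_e = w_e^(p−2). Suppose some Δ* satisfies AΔ* = c, Δ*ᵀMᵀMΔ* ≤ ζ, and ‖NΔ*‖_p^p ≤ ζ. Then the infimum over {Δ : AΔ = c} of the objective m₁^((p−2)/p)·ζ^(−(p−2)/p)·ΔᵀMᵀMΔ + (1/3^(p−2))·Σ_e r_e·(NΔ)_e² is at most ζ^(2/p)·( m₁^((p−2)/p) + (1/3^(p−2))·‖w‖_p^(p−2) ). -/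
open Matrix

theorem stmt_15 (p : ℝ) (hp : 2 ≤ p) (ζ : ℝ) (hζ : 0 < ζ)
    (d n m₁ m₂ : ℕ)
    (A : Matrix (Fin d) (Fin n) ℝ) (M : Matrix (Fin m₂) (Fin n) ℝ)
    (N : Matrix (Fin m₁) (Fin n) ℝ) (c : Fin d → ℝ)
    (w : Fin m₁ → ℝ) (hw : ∀ e, 1 ≤ w e)
    (r : Fin m₁ → ℝ) (hr : ∀ e, r e = w e ^ (p - 2))
    (obj : (Fin n → ℝ) → ℝ)
    (hobj : ∀ Δ, obj Δ = (m₁ : ℝ) ^ ((p - 2) / p) * ζ ^ (-((p - 2) / p))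
        * (Δ ⬝ᵥ (Mᵀ * M).mulVec Δ)
        + (1 / (3 : ℝ) ^ (p - 2)) * ∑ e, r e * (N.mulVec Δ e) ^ 2)
    (Δs : Fin n → ℝ) (hfeas : A.mulVec Δs = c)
    (hq : Δs ⬝ᵥ (Mᵀ * M).mulVec Δs ≤ ζ)
    (hlp : ∑ e, |N.mulVec Δs e| ^ p ≤ ζ) :
    sInf (obj '' {Δ | A.mulVec Δ = c})
      ≤ ζ ^ (2 / p) * ((m₁ : ℝ) ^ ((p - 2) / p)
          + (1 / (3 : ℝ) ^ (p - 2)) * ((∑ e, |w e| ^ p) ^ (1 / p)) ^ (p - 2)) := by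
  have hp0 : 0 < p := by linarith
  have hQ : ∀ Δ : Fin n → ℝ, 0 ≤ Δ ⬝ᵥ (Mᵀ * M).mulVec Δ := by
    intro Δ
    rw [← Matrix.mulVec_mulVec, Matrix.dotProduct_mulVec, Matrix.vecMul_transpose]
    exact Finset.sum_nonneg fun i _ => mul_self_nonneg _
  have hr0 : ∀ e, 0 ≤ r e := by
    intro e
    rw [hr]
    exact Real.rpow_nonneg (by linarith [hw e]) _
  have hbdd : BddBelow (obj '' {Δ | A.mulVec Δ = c}) := by
    refine ⟨0, ?_⟩
    rintro _ ⟨Δ, -, rfl⟩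
    rw [hobj]
    have h1 := hQ Δ
    have h2 : 0 ≤ ∑ e, r e * (N.mulVec Δ e) ^ 2 :=
      Finset.sum_nonneg fun e _ => mul_nonneg (hr0 e) (sq_nonneg _)
    positivity
  refine (csInf_le hbdd ⟨Δs, hfeas, rfl⟩).trans ?_
  have hholder : ∑ e, r e * (N.mulVec Δs e) ^ 2
      ≤ ζ ^ (2 / p) * ((∑ e, |w e| ^ p) ^ (1 / p)) ^ (p - 2) := by
    rcases hp.eq_or_lt with h2 | h2
    · subst h2
      have : ∀ e, r e * (N.mulVec Δs e) ^ 2 = |N.mulVec Δs e| ^ (2 : ℝ) := by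
        intro e
        rw [hr]
        simp
      simp only [this]
      simpa using hlp
    · have hp2 : 0 < p - 2 := by linarith
      have hc : (p / (p - 2)).HolderConjugate (p / 2) := by
        rw [Real.holderConjugate_iff]
        constructor
        · rw [lt_div_iff₀ hp2]; linarith
        · field_simp; ring
      have key := Real.inner_le_Lp_mul_Lq Finset.univ r (fun e => (N.mulVec Δs e) ^ 2) hc
      have e1 : ∀ e, |r e| ^ (p / (p - 2)) = |w e| ^ p := by
        intro e
        have hwe : 0 ≤ w e := by linarith [hw e]
        rw [abs_of_nonneg (hr0 e), hr, abs_of_nonneg hwe, ← Real.rpow_mul hwe]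
        congr 1
        field_simp
      have e2 : ∀ e, |(N.mulVec Δs e) ^ 2| ^ (p / 2) = |N.mulVec Δs e| ^ p := by
        intro e
        rw [abs_pow, ← Real.rpow_natCast, ← Real.rpow_mul (abs_nonneg _)]
        congr 1
        push_cast
        field_simp
      simp only [e1, e2] at key
      refine key.trans ?_
      have hW : 0 ≤ ∑ e, |w e| ^ p := Finset.sum_nonneg fun e _ => by positivity
      have hN : 0 ≤ ∑ e, |N.mulVec Δs e| ^ p := Finset.sum_nonneg fun e _ => by positivity
      rw [← Real.rpow_mul hW, mul_comm, one_div_div, one_div_div, one_div_mul_eq_div]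
      gcongr
  have hz : ζ ^ (-((p - 2) / p)) * ζ = ζ ^ (2 / p) := by
    nth_rewrite 2 [← Real.rpow_one ζ]
    rw [← Real.rpow_add hζ]
    congr 1
    field_simp
    ring
  rw [hobj, mul_add]
  refine add_le_add ?_ ?_
  · calc _ ≤ (m₁ : ℝ) ^ ((p - 2) / p) * ζ ^ (-((p - 2) / p)) * ζ :=
          mul_le_mul_of_nonneg_left hq (by positivity)
      _ = _ := by rw [mul_assoc, hz, mul_comm]
  · rw [mul_left_comm]
    exact mul_le_mul_of_nonneg_left hholder (by positivity)
end

section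
/- Let p ≥ 2 be a real number and let ζ, τ, ρ, β, Ψ > 0 be reals. Let r, v ∈ ℝ^m satisfy r_e ≥ 1 for all e, Σ_e r_e·v_e² ≤ 3^(p−2)·Ψ, and ‖v‖_p^p ≥ τ·ζ. Assume τ^(2/p)·ζ^(2/p) ≥ 4·3^(p−2)·Ψ/β and τ·ζ^(2/p) ≥ 2·3^(p−2)·Ψ·ρ^(p−2). Let H = { e : |v_e| > ρ·ζ^(1/p) and r_e ≤ β }. Then Σ_{e ∈ H} v_e² ≥ (1/4)·τ^(2/p)·ζ^(2/p), and consequently Σ_{e ∈ H} r_e·v_e² ≥ (1/4)·τ^(2/p)·ζ^(2/p). -/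
open Finset

theorem sum_rpow_le_aux {ι : Type*} (s : Finset ι) (f : ι → ℝ) (hf : ∀ i, 0 ≤ f i) (q : ℝ)
    (hq : 1 ≤ q) : ∑ i ∈ s, f i ^ q ≤ (∑ i ∈ s, f i) ^ q := by
  classical
  induction s using Finset.induction_on with
  | empty => simp [Real.zero_rpow (by linarith : q ≠ 0)]
  | insert a s ha ih =>
    rw [Finset.sum_insert ha, Finset.sum_insert ha]
    have := Real.add_rpow_le_rpow_add (hf a) (Finset.sum_nonneg (fun i (_ : i ∈ s) => hf i)) hq
    linarith

theorem stmt_16 (p : ℝ) (hp : 2 ≤ p) (ζ τ ρ β Ψ : ℝ)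
    (hζ : 0 < ζ) (hτ : 0 < τ) (hρ : 0 < ρ) (hβ : 0 < β) (hΨ : 0 < Ψ)
    (m : ℕ) (r v : Fin m → ℝ) (hr : ∀ e, 1 ≤ r e)
    (h1 : ∑ e, r e * (v e) ^ 2 ≤ (3 : ℝ) ^ (p - 2) * Ψ)
    (h2 : τ * ζ ≤ ∑ e, |v e| ^ p)
    (h3 : 4 * (3 : ℝ) ^ (p - 2) * Ψ / β ≤ τ ^ (2 / p) * ζ ^ (2 / p))
    (h4 : 2 * (3 : ℝ) ^ (p - 2) * Ψ * ρ ^ (p - 2) ≤ τ * ζ ^ (2 / p)) :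
    (1 / 4) * τ ^ (2 / p) * ζ ^ (2 / p)
      ≤ (∑ e ∈ Finset.univ.filter (fun e => ρ * ζ ^ (1 / p) < |v e| ∧ r e ≤ β), (v e) ^ 2) ∧
    (1 / 4) * τ ^ (2 / p) * ζ ^ (2 / p)
      ≤ ∑ e ∈ Finset.univ.filter (fun e => ρ * ζ ^ (1 / p) < |v e| ∧ r e ≤ β),
          r e * (v e) ^ 2 := by
  have hp0 : 0 < p := by linarith
  set K : ℝ := (3 : ℝ) ^ (p - 2) * Ψ with hK
  set T : ℝ := τ ^ (2 / p) * ζ ^ (2 / p) with hT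
  have hTeq : T = (τ * ζ) ^ (2 / p) := by rw [hT, Real.mul_rpow hτ.le hζ.le]
  have hpow : ∀ e, |v e| ^ p = (v e ^ 2) ^ (p / 2) := by
    intro e
    rw [← sq_abs, ← Real.rpow_natCast, ← Real.rpow_mul (abs_nonneg _)]
    congr 1
    push_cast
    ring
  have hv2 : ∑ e, v e ^ 2 ≤ K := by
    refine le_trans (Finset.sum_le_sum fun e _ => ?_) h1
    nlinarith [hr e, sq_nonneg (v e)]
  set B := Finset.univ.filter (fun e => ρ * ζ ^ (1 / p) < |v e|) with hB
  set C := Finset.univ.filter (fun e => ¬ ρ * ζ ^ (1 / p) < |v e|) with hC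
  have hsplit : ∑ e ∈ B, |v e| ^ p + ∑ e ∈ C, |v e| ^ p = ∑ e, |v e| ^ p :=
    Finset.sum_filter_add_sum_filter_not _ _ _
  set c : ℝ := (ρ * ζ ^ (1 / p)) ^ (p - 2) with hc
  have hc0 : 0 ≤ c := by positivity
  have hCle : ∑ e ∈ C, |v e| ^ p ≤ c * K := by
    calc ∑ e ∈ C, |v e| ^ p ≤ ∑ e ∈ C, c * v e ^ 2 := by
          refine Finset.sum_le_sum fun e he => ?_
          have he' : |v e| ≤ ρ * ζ ^ (1 / p) := by simpa [hC] using he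
          have h5 : |v e| ^ (p - 2) ≤ c :=
            Real.rpow_le_rpow (abs_nonneg _) he' (by linarith)
          have h6 : |v e| ^ p = |v e| ^ (p - 2) * v e ^ 2 := by
            have h7 : |v e| ^ p = |v e| ^ ((p - 2) + 2) := by congr 1; ring
            rw [h7, Real.rpow_add_of_nonneg (abs_nonneg _) (by linarith) (by norm_num)]
            congr 1
            rw [Real.rpow_two, sq_abs]
          rw [h6]
          exact mul_le_mul_of_nonneg_right h5 (sq_nonneg _)
      _ ≤ ∑ e, c * v e ^ 2 :=
          Finset.sum_le_sum_of_subset_of_nonneg (Finset.subset_univ _)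
            (fun e _ _ => mul_nonneg hc0 (sq_nonneg _))
      _ = c * ∑ e, v e ^ 2 := by rw [Finset.mul_sum]
      _ ≤ c * K := mul_le_mul_of_nonneg_left hv2 hc0
  have hcK : c * K ≤ τ * ζ / 2 := by
    have h8 : c = ρ ^ (p - 2) * ζ ^ (1 - 2 / p) := by
      rw [hc, Real.mul_rpow hρ.le (by positivity), ← Real.rpow_mul hζ.le]
      congr 2
      field_simp
    have h9 : ζ ^ (1 - 2 / p) * ζ ^ (2 / p) = ζ := by
      rw [← Real.rpow_add hζ]; simp
    have h10 : 0 < ζ ^ (1 - 2 / p) := by positivity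
    have h11 := mul_le_mul_of_nonneg_left h4 h10.le
    have h12 : ζ ^ (1 - 2 / p) * (τ * ζ ^ (2 / p)) = τ * ζ := by
      rw [mul_left_comm, h9]
    rw [h12] at h11
    rw [h8, hK]
    linarith
  have hBp : τ * ζ / 2 ≤ (∑ e ∈ B, v e ^ 2) ^ (p / 2) := by
    have h13 := sum_rpow_le_aux B (fun e => v e ^ 2) (fun e => sq_nonneg _) (p / 2) (by linarith)
    simp only [← hpow] at h13
    linarith
  have hS0 : 0 ≤ ∑ e ∈ B, v e ^ 2 := Finset.sum_nonneg fun e _ => sq_nonneg _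
  have hBT : T / 2 ≤ ∑ e ∈ B, v e ^ 2 := by
    have h14 := Real.rpow_le_rpow (by positivity) hBp (by positivity : 0 ≤ 2 / p)
    rw [← Real.rpow_mul hS0, show p / 2 * (2 / p) = 1 by field_simp, Real.rpow_one,
      Real.div_rpow (by positivity) (by norm_num), ← hTeq] at h14
    refine le_trans ?_ h14
    have h15 : (2 : ℝ) ^ (2 / p) ≤ 2 := by
      have := Real.rpow_le_rpow_of_exponent_le (x := 2) (by norm_num)
        (show 2 / p ≤ 1 by rw [div_le_one hp0]; exact hp)
      simpa using this
    have hT0 : 0 ≤ T := by positivity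
    exact div_le_div_of_nonneg_left hT0 (by positivity) h15
  have hsplit2 : ∑ e ∈ B.filter (fun e => r e ≤ β), v e ^ 2
      + ∑ e ∈ B.filter (fun e => ¬ r e ≤ β), v e ^ 2 = ∑ e ∈ B, v e ^ 2 :=
    Finset.sum_filter_add_sum_filter_not _ _ _
  have hD : ∑ e ∈ B.filter (fun e => ¬ r e ≤ β), v e ^ 2 ≤ T / 4 := by
    have h16 : β * ∑ e ∈ B.filter (fun e => ¬ r e ≤ β), v e ^ 2 ≤ K := by
      rw [Finset.mul_sum]
      refine le_trans (Finset.sum_le_sum (g := fun e => r e * v e ^ 2) fun e he => ?_)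
        (le_trans (Finset.sum_le_sum_of_subset_of_nonneg (Finset.subset_univ _)
          fun e _ _ => ?_) h1)
      · have := (Finset.mem_filter.1 he).2
        exact mul_le_mul_of_nonneg_right (by linarith) (sq_nonneg _)
      · exact mul_nonneg (by linarith [hr e]) (sq_nonneg _)
    rw [div_le_iff₀ hβ] at h3
    refine le_of_mul_le_mul_left ?_ hβ
    linarith
  rw [hB, Finset.filter_filter, ← hB] at hsplit2
  have hmain : (1 / 4) * τ ^ (2 / p) * ζ ^ (2 / p) ≤
      ∑ e ∈ Finset.univ.filter (fun e => ρ * ζ ^ (1 / p) < |v e| ∧ r e ≤ β), (v e) ^ 2 := by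
    have : (1 / 4) * τ ^ (2 / p) * ζ ^ (2 / p) = T / 4 := by rw [hT]; ring
    linarith
  refine ⟨hmain, hmain.trans (Finset.sum_le_sum fun e _ => ?_)⟩
  nlinarith [hr e, sq_nonneg (v e)]
end

section
/- Let p ≥ 2 be a real number, N ∈ ℝ^(m×n), A ∈ ℝ^(d×n), x ∈ ℝ^n, and ν > 0. Set g = Diag(|Nx|^(p−2))·Nx ∈ ℝ^m, R = 2·Diag(|Nx|^(p−2)) ∈ ℝ^(m×m) (with the convention 0^(p−2) = 0), and s = ν^((p−2)/p)·m^(−(p−2)/p). Suppose Δ* satisfies AΔ* = 0, gᵀNΔ* > ν/(32p), Δ*ᵀNᵀRNΔ* ≤ ν, and ‖NΔ*‖_p^p ≤ ν. Then, with a = 1/(2^7·p), the vector a·Δ* satisfies A(aΔ*) = 0 and gᵀN(aΔ*) − (aΔ*)ᵀNᵀ(R + s·I)N(aΔ*) ≥ ν/(2^13·p²). In particular, the maximum of gᵀNΔ − ΔᵀNᵀ(R + s·I)NΔ over {Δ : AΔ = 0} is at least ν/(2^13·p²). -/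
open Matrix

lemma reg_bound (p : ℝ) (hp : 2 ≤ p) (m : ℕ) (hm : 0 < m) (ν : ℝ) (hν : 0 < ν)
    (u : Fin m → ℝ) (hlp : ∑ e, |u e| ^ p ≤ ν) :
    (ν ^ ((p - 2) / p) * (m : ℝ) ^ (-((p - 2) / p))) * (u ⬝ᵥ u) ≤ ν := by
  have hm' : (0 : ℝ) < m := by exact_mod_cast hm
  have hp0 : 0 < p := by linarith
  have hs : ν ^ ((p - 2) / p) * (m : ℝ) ^ (-((p - 2) / p)) = (ν / m) ^ ((p - 2) / p) := by
    rw [Real.div_rpow hν.le hm'.le, Real.rpow_neg hm'.le, div_eq_mul_inv (ν ^ _)]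
  rw [hs]
  have key : ∀ e, (ν / m) ^ ((p - 2) / p) * (u e * u e)
      ≤ (p - 2) / p * (ν / m) + 2 / p * |u e| ^ p := by
    intro e
    have h := Real.geom_mean_le_arith_mean2_weighted (w₁ := (p - 2) / p) (w₂ := 2 / p)
      (p₁ := ν / m) (p₂ := |u e| ^ p) (div_nonneg (by linarith) hp0.le) (by positivity)
      (by positivity) (by positivity) (by field_simp; ring)
    have h2 : (|u e| ^ p) ^ (2 / p) = u e * u e := by
      rw [← Real.rpow_mul (abs_nonneg _), mul_div_cancel₀ _ hp0.ne', Real.rpow_two, sq_abs, sq]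
    rwa [h2] at h
  calc (ν / m) ^ ((p - 2) / p) * (u ⬝ᵥ u)
      = ∑ e, (ν / m) ^ ((p - 2) / p) * (u e * u e) := by
        rw [dotProduct, Finset.mul_sum]
    _ ≤ ∑ e, ((p - 2) / p * (ν / m) + 2 / p * |u e| ^ p) := Finset.sum_le_sum fun e _ => key e
    _ = (p - 2) / p * ν + 2 / p * ∑ e, |u e| ^ p := by
        rw [Finset.sum_add_distrib, ← Finset.mul_sum, ← Finset.mul_sum]
        simp only [Finset.sum_const, Finset.card_univ, Fintype.card_fin, nsmul_eq_mul]
        field_simp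
    _ ≤ (p - 2) / p * ν + 2 / p * ν := by gcongr
    _ = ν := by field_simp; ring

theorem stmt_18 (p : ℝ) (hp : 2 ≤ p) (m n d : ℕ)
    (N : Matrix (Fin m) (Fin n) ℝ) (A : Matrix (Fin d) (Fin n) ℝ)
    (x : Fin n → ℝ) (ν : ℝ) (hν : 0 < ν)
    (g : Fin m → ℝ)
    (hg : ∀ e, g e = (if N.mulVec x e = 0 then 0 else |N.mulVec x e| ^ (p - 2)) * N.mulVec x e)
    (R : Matrix (Fin m) (Fin m) ℝ)
    (hR : R = (2 : ℝ) • Matrix.diagonal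
        (fun e => if N.mulVec x e = 0 then 0 else |N.mulVec x e| ^ (p - 2)))
    (s : ℝ) (hs : s = ν ^ ((p - 2) / p) * (m : ℝ) ^ (-((p - 2) / p)))
    (Δs : Fin n → ℝ) (hfeas : A.mulVec Δs = 0)
    (hlin : ν / (32 * p) < g ⬝ᵥ N.mulVec Δs)
    (hquad : N.mulVec Δs ⬝ᵥ R.mulVec (N.mulVec Δs) ≤ ν)
    (hlp : ∑ e, |N.mulVec Δs e| ^ p ≤ ν)
    (a : ℝ) (ha : a = 1 / ((2 : ℝ) ^ 7 * p)) :
    A.mulVec (a • Δs) = 0 ∧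
    ν / ((2 : ℝ) ^ 13 * p ^ 2)
      ≤ g ⬝ᵥ N.mulVec (a • Δs)
        - N.mulVec (a • Δs) ⬝ᵥ (R + s • (1 : Matrix (Fin m) (Fin m) ℝ)).mulVec
            (N.mulVec (a • Δs)) ∧
    ∃ Δ : Fin n → ℝ, A.mulVec Δ = 0 ∧
      ν / ((2 : ℝ) ^ 13 * p ^ 2)
        ≤ g ⬝ᵥ N.mulVec Δ
          - N.mulVec Δ ⬝ᵥ (R + s • (1 : Matrix (Fin m) (Fin m) ℝ)).mulVec (N.mulVec Δ) := by
  have hA : A.mulVec (a • Δs) = 0 := by rw [Matrix.mulVec_smul, hfeas, smul_zero]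
  have hp0 : 0 < p := by linarith
  have hm : 0 < m := by
    rcases Nat.eq_zero_or_pos m with h | h
    · subst h
      have : 0 < ν / (32 * p) := by positivity
      simp [dotProduct] at hlin
      linarith
    · exact h
  have hreg := reg_bound p hp m hm ν hν (N.mulVec Δs) hlp
  rw [← hs] at hreg
  have ha0 : 0 < a := by rw [ha]; positivity
  have main : ν / ((2 : ℝ) ^ 13 * p ^ 2)
      ≤ g ⬝ᵥ N.mulVec (a • Δs)
        - N.mulVec (a • Δs) ⬝ᵥ (R + s • (1 : Matrix (Fin m) (Fin m) ℝ)).mulVec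
            (N.mulVec (a • Δs)) := by
    rw [Matrix.mulVec_smul]
    generalize N.mulVec Δs = u at *
    have e : g ⬝ᵥ (a • u) - (a • u) ⬝ᵥ (R + s • (1 : Matrix (Fin m) (Fin m) ℝ)).mulVec (a • u)
        = a * (g ⬝ᵥ u) - a ^ 2 * (u ⬝ᵥ R.mulVec u + s * (u ⬝ᵥ u)) := by
      simp only [Matrix.mulVec_smul, Matrix.add_mulVec, Matrix.smul_mulVec, Matrix.one_mulVec,
        dotProduct_smul, smul_dotProduct, dotProduct_add, smul_eq_mul]
      ring
    rw [e]
    have h1 : a * (ν / (32 * p)) ≤ a * (g ⬝ᵥ u) := by gcongr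
    have h2 : a ^ 2 * (u ⬝ᵥ R.mulVec u + s * (u ⬝ᵥ u)) ≤ a ^ 2 * (ν + ν) := by gcongr
    have h3 : ν / ((2 : ℝ) ^ 13 * p ^ 2) = a * (ν / (32 * p)) - a ^ 2 * (ν + ν) := by
      rw [ha]; field_simp; ring
    linarith
  exact ⟨hA, main, a • Δs, hA, main⟩
end

section
/- Let p ≥ 2 be a real number, N ∈ ℝ^(m×n), A ∈ ℝ^(d×n), x ∈ ℝ^n, and ν > 0. Set g = Diag(|Nx|^(p−2))·Nx, R = 2·Diag(|Nx|^(p−2)) (with the convention 0^(p−2) = 0), and s = ν^((p−2)/p)·m^(−(p−2)/p). Suppose Δ̃ satisfies AΔ̃ = 0, NΔ̃ ≠ 0, and gᵀNΔ̃ − Δ̃ᵀNᵀ(R + s·I)NΔ̃ ≥ ν/(2^13·p²). Define k = ‖NΔ̃‖_p^p / (Δ̃ᵀNᵀ(R + s·I)NΔ̃) and α₀ = min(1/2, 1/(2k)^(1/(p−1))). Then res_p(α₀·Δ̃) := α₀·gᵀNΔ̃ − α₀²·Δ̃ᵀNᵀRNΔ̃ − α₀^p·‖NΔ̃‖_p^p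 ≥ (α₀/(2^13·p²))·ν. Moreover, if additionally gᵀNΔ̃ ≤ ν, then k ≤ m^((p−2)/2) and hence α₀ ≥ (1/2)·m^(−(p−2)/(2(p−1))). -/
open Matrix

lemma sum_rpow_bound {m : ℕ} (p : ℝ) (hp : 2 ≤ p) (y : Fin m → ℝ) :
    ∑ e, |y e| ^ p ≤ (∑ e, y e ^ 2) * (∑ e, y e ^ 2) ^ ((p - 2) / 2) := by
  rw [Finset.sum_mul]
  apply Finset.sum_le_sum
  intro e _
  have h1 : |y e| ^ p = y e ^ 2 * (y e ^ 2) ^ ((p - 2) / 2) := by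
    have : |y e| ^ p = |y e| ^ ((2 : ℝ) + (p - 2)) := by congr 1; ring
    rw [this, Real.rpow_add' (abs_nonneg _) (by linarith), Real.rpow_two, sq_abs]
    congr 1
    rw [← sq_abs, ← Real.rpow_two, ← Real.rpow_mul (abs_nonneg _)]
    congr 1; ring
  rw [h1]
  have h2 : y e ^ 2 ≤ ∑ e, y e ^ 2 :=
    Finset.single_le_sum (f := fun e => y e ^ 2) (fun i _ => sq_nonneg _) (Finset.mem_univ e)
  apply mul_le_mul_of_nonneg_left _ (sq_nonneg _)
  exact Real.rpow_le_rpow (sq_nonneg _) h2 (by linarith)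

theorem stmt_19 (p : ℝ) (hp : 2 ≤ p) (m n d : ℕ)
    (N : Matrix (Fin m) (Fin n) ℝ) (A : Matrix (Fin d) (Fin n) ℝ)
    (x : Fin n → ℝ) (ν : ℝ) (hν : 0 < ν)
    (g : Fin m → ℝ)
    (hg : ∀ e, g e = (if N.mulVec x e = 0 then 0 else |N.mulVec x e| ^ (p - 2)) * N.mulVec x e)
    (R : Matrix (Fin m) (Fin m) ℝ)
    (hR : R = (2 : ℝ) • Matrix.diagonal
        (fun e => if N.mulVec x e = 0 then 0 else |N.mulVec x e| ^ (p - 2)))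
    (s : ℝ) (hs : s = ν ^ ((p - 2) / p) * (m : ℝ) ^ (-((p - 2) / p)))
    (Δt : Fin n → ℝ) (hfeas : A.mulVec Δt = 0) (hnz : N.mulVec Δt ≠ 0)
    (hval : ν / ((2 : ℝ) ^ 13 * p ^ 2)
        ≤ g ⬝ᵥ N.mulVec Δt
          - N.mulVec Δt ⬝ᵥ (R + s • (1 : Matrix (Fin m) (Fin m) ℝ)).mulVec (N.mulVec Δt))
    (k : ℝ)
    (hk : k = (∑ e, |N.mulVec Δt e| ^ p)
        / (N.mulVec Δt ⬝ᵥ (R + s • (1 : Matrix (Fin m) (Fin m) ℝ)).mulVec (N.mulVec Δt)))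
    (α₀ : ℝ) (hα₀ : α₀ = min (1 / 2) (1 / (2 * k) ^ (1 / (p - 1)))) :
    α₀ / ((2 : ℝ) ^ 13 * p ^ 2) * ν
      ≤ α₀ * (g ⬝ᵥ N.mulVec Δt)
        - α₀ ^ 2 * (N.mulVec Δt ⬝ᵥ R.mulVec (N.mulVec Δt))
        - α₀ ^ p * ∑ e, |N.mulVec Δt e| ^ p ∧
    (g ⬝ᵥ N.mulVec Δt ≤ ν →
      k ≤ (m : ℝ) ^ ((p - 2) / 2) ∧
      (1 / 2) * (m : ℝ) ^ (-((p - 2) / (2 * (p - 1)))) ≤ α₀) := by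
  clear hfeas hg
  set y := N.mulVec Δt with hy
  set P := ∑ e, |y e| ^ p with hP
  set G := g ⬝ᵥ y with hG
  set B := y ⬝ᵥ R.mulVec y with hB
  set S := ∑ e, y e ^ 2 with hS
  have hQ : y ⬝ᵥ (R + s • (1 : Matrix (Fin m) (Fin m) ℝ)).mulVec y = B + s * S := by
    rw [Matrix.add_mulVec, dotProduct_add, Matrix.smul_mulVec, Matrix.one_mulVec,
      dotProduct_smul, hB, hS, smul_eq_mul]
    congr 2
    simp [dotProduct, sq]
  rw [hQ] at hval hk
  have hB0 : 0 ≤ B := by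
    rw [hB, hR, Matrix.smul_mulVec, dotProduct_smul, smul_eq_mul]
    apply mul_nonneg (by norm_num)
    unfold dotProduct
    apply Finset.sum_nonneg
    intro e _
    rw [Matrix.mulVec_diagonal]
    have : 0 ≤ (if N.mulVec x e = 0 then 0 else |N.mulVec x e| ^ (p - 2)) := by
      split_ifs
      · exact le_rfl
      · positivity
    nlinarith [mul_nonneg this (mul_self_nonneg (y e))]
  obtain ⟨e0, he0⟩ := Function.ne_iff.mp hnz
  simp only [Pi.zero_apply] at he0
  have hm1 : (1 : ℝ) ≤ m := by
    have : 0 < m := e0.pos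
    exact_mod_cast this
  have hm0 : (0 : ℝ) < m := by linarith
  have hs0 : 0 < s := by rw [hs]; positivity
  have hS0 : 0 < S := Finset.sum_pos' (fun i _ => sq_nonneg _) ⟨e0, Finset.mem_univ _, by positivity⟩
  have hP0 : 0 < P := Finset.sum_pos' (fun i _ => by positivity)
    ⟨e0, Finset.mem_univ _, by have := abs_pos.mpr he0; positivity⟩
  have hsS : 0 < s * S := mul_pos hs0 hS0
  have hQ0 : 0 < B + s * S := by linarith
  have hk0 : 0 < k := by rw [hk]; positivity
  have hPk : P = k * (B + s * S) := by rw [hk]; field_simp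
  have hp1 : 0 < p - 1 := by linarith
  have hα0 : 0 < α₀ := by rw [hα₀]; positivity
  have hα1 : α₀ ≤ 1 / 2 := by rw [hα₀]; exact min_le_left _ _
  have hα2 : α₀ ≤ 1 / (2 * k) ^ (1 / (p - 1)) := by rw [hα₀]; exact min_le_right _ _
  have hv0 : 0 < ν / ((2 : ℝ) ^ 13 * p ^ 2) := by positivity
  refine ⟨?_, ?_⟩
  · have h1 : α₀ ^ (p - 1) ≤ 1 / (2 * k) := by
      refine (Real.rpow_le_rpow hα0.le hα2 hp1.le).trans (le_of_eq ?_)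
      rw [Real.div_rpow zero_le_one (by positivity), Real.one_rpow,
        ← Real.rpow_mul (by positivity), one_div_mul_cancel hp1.ne', Real.rpow_one]
    have h2 : α₀ ^ p = α₀ * α₀ ^ (p - 1) := by
      rw [Real.rpow_sub_one hα0.ne']; field_simp
    have h3 : α₀ ^ (p - 1) * P ≤ (B + s * S) / 2 := by
      calc α₀ ^ (p - 1) * P ≤ 1 / (2 * k) * P := by gcongr
        _ = _ := by rw [hPk]; field_simp
    have h4 : α₀ * B ≤ (B + s * S) / 2 := by nlinarith
    have h5 : ν / ((2 : ℝ) ^ 13 * p ^ 2) ≤ G - α₀ * B - α₀ ^ (p - 1) * P := by linarith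
    calc α₀ / ((2 : ℝ) ^ 13 * p ^ 2) * ν = α₀ * (ν / ((2 : ℝ) ^ 13 * p ^ 2)) := by ring
      _ ≤ α₀ * (G - α₀ * B - α₀ ^ (p - 1) * P) := by gcongr
      _ = _ := by rw [h2]; ring
  · intro hGν
    have hSν : S ≤ ν / s := by
      rw [le_div_iff₀ hs0]; linarith
    have hc : 0 ≤ (p - 2) / 2 := by linarith
    have hp0 : p ≠ 0 := by linarith
    have hs1 : s * s ^ ((p - 2) / 2) * (m : ℝ) ^ ((p - 2) / 2) = ν ^ ((p - 2) / 2) := by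
      have e1 : s * s ^ ((p - 2) / 2) = s ^ (p / 2) := by
        rw [← Real.rpow_one_add' hs0.le (by linarith)]; congr 1; ring
      rw [e1, hs, Real.mul_rpow (by positivity) (by positivity), ← Real.rpow_mul hν.le,
        ← Real.rpow_mul hm0.le, mul_assoc, ← Real.rpow_add hm0]
      have e2 : (p - 2) / p * (p / 2) = (p - 2) / 2 := by field_simp
      have e3 : -((p - 2) / p) * (p / 2) + (p - 2) / 2 = 0 := by rw [neg_mul, e2]; ring
      rw [e2, e3, Real.rpow_zero, mul_one]
    have hkm : k ≤ (m : ℝ) ^ ((p - 2) / 2) := by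
      have hb : P ≤ S * S ^ ((p - 2) / 2) := sum_rpow_bound p hp y
      have hb2 : S ^ ((p - 2) / 2) ≤ s * (m : ℝ) ^ ((p - 2) / 2) := by
        refine (Real.rpow_le_rpow hS0.le hSν hc).trans (le_of_eq ?_)
        have : 0 < s ^ ((p - 2) / 2) := by positivity
        rw [Real.div_rpow hν.le hs0.le, ← hs1]
        field_simp
      rw [hk, div_le_iff₀ hQ0]
      have hm' : 0 ≤ (m : ℝ) ^ ((p - 2) / 2) := by positivity
      nlinarith [mul_le_mul_of_nonneg_left hb2 hS0.le, mul_nonneg hm' hB0]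
    refine ⟨hkm, ?_⟩
    have hexp : 0 ≤ (p - 2) / (2 * (p - 1)) := div_nonneg (by linarith) (by linarith)
    rw [hα₀, Real.rpow_neg hm0.le]
    have hM : 1 ≤ (m : ℝ) ^ ((p - 2) / (2 * (p - 1))) := Real.one_le_rpow hm1 hexp
    apply le_min
    · have := inv_le_one_of_one_le₀ hM
      linarith
    · have h6 : (2 * k) ^ (1 / (p - 1)) ≤ 2 * (m : ℝ) ^ ((p - 2) / (2 * (p - 1))) := by
        have h7 : (2 * k) ^ (1 / (p - 1)) ≤ (2 * (m : ℝ) ^ ((p - 2) / 2)) ^ (1 / (p - 1)) :=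
          Real.rpow_le_rpow (by positivity) (by linarith) (by positivity)
        refine h7.trans ?_
        rw [Real.mul_rpow (by norm_num) (by positivity), ← Real.rpow_mul hm0.le]
        have e4 : (p - 2) / 2 * (1 / (p - 1)) = (p - 2) / (2 * (p - 1)) := by
          field_simp
        rw [e4]
        have h8 : (2 : ℝ) ^ (1 / (p - 1)) ≤ 2 := by
          conv_rhs => rw [← Real.rpow_one 2]
          apply Real.rpow_le_rpow_of_exponent_le (by norm_num)
          rw [div_le_one hp1]; linarith
        gcongr
      have h9 : 0 < (2 * k) ^ (1 / (p - 1)) := by positivity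
      calc 1 / 2 * ((m : ℝ) ^ ((p - 2) / (2 * (p - 1))))⁻¹
          = 1 / (2 * (m : ℝ) ^ ((p - 2) / (2 * (p - 1)))) := by rw [one_div, one_div, mul_inv]
        _ ≤ _ := one_div_le_one_div_of_le h9 h6
end
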